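/- arXiv:1806.03638 — 2 statements merged into one kernel-verified Lean document; each statement's English description precedes it below -/
import Mathlib

section
/- Lawler–Zhan null-vector equation for the screened partition function, excursion-reflected boundary condition: fix κ > 4. For r > 0 and x ∈ (0,2π), define Z(r,x) := Θ′(r,0)^{6/κ} · Θ(r,x)^{2/κ} · ∫_0^x Θ(r,x−t)^{−4/κ} Θ(r,t)^{−4/κ} dt (the integral converges since −4/κ > −1, and all powers are real powers of positive reals). Then Z(r,x) > 0 and ∂_r Z = (κ/2)·∂_x² Z + H(r,x)·∂_x Z + (3/κ − 1/2)·H′(r,x)·Z − (6/κ)·(ζ_r(π)/π)·Z on (0,∞) × (0,2π). -/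
open Complex

/-- The theta function Θ(r,z) = (1/i)·∑_{n∈ℤ} (−1)^n e^{−r(n+1/2)²} e^{(n+1/2)iz}. -/
noncomputable def Theta (r : ℝ) (z : ℂ) : ℂ :=
  (1 / Complex.I) * ∑' n : ℤ, (-1 : ℂ) ^ n *
    Complex.exp (-(r : ℂ) * ((n : ℂ) + 1 / 2) ^ 2) *
    Complex.exp (((n : ℂ) + 1 / 2) * Complex.I * z)

/-- The Loewner kernel H(r,z) = 2 Θ′(r,z)/Θ(r,z). -/
noncomputable def Hker (r : ℝ) (z : ℂ) : ℂ := 2 * deriv (Theta r) z / Theta r z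

/-- The lattice L_r = 2πℤ + 2irℤ. -/
def ThetaLattice (r : ℝ) : Set ℂ :=
  {z | ∃ m n : ℤ, z = 2 * (Real.pi : ℂ) * m + 2 * Complex.I * r * n}

/-- Lattice point 2πm + 2irn. -/
noncomputable def latPt (r : ℝ) (p : ℤ × ℤ) : ℂ :=
  2 * (Real.pi : ℂ) * p.1 + 2 * Complex.I * (r : ℂ) * p.2

/-- The Weierstrass zeta function with periods (2π, 2ir). -/
noncomputable def wzeta (r : ℝ) (z : ℂ) : ℂ :=
  1 / z + ∑' p : ℤ × ℤ, if p = 0 then 0 else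
    (1 / (z - latPt r p) + 1 / latPt r p + z / latPt r p ^ 2)

/-- The screened annulus SLE partition function (excursion-reflected case). -/
noncomputable def ZLZ (κ r x : ℝ) : ℝ :=
  ((deriv (Theta r) 0).re) ^ ((6 : ℝ) / κ) *
  ((Theta r (x : ℂ)).re) ^ ((2 : ℝ) / κ) *
  ∫ t in (0 : ℝ)..x,
    ((Theta r ((x - t : ℝ) : ℂ)).re) ^ (-((4 : ℝ) / κ)) *
    ((Theta r (t : ℂ)).re) ^ (-((4 : ℝ) / κ))

open Complex

/-- k-th z-derivative term of the theta series. -/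
noncomputable def thT (k : ℕ) (s : ℝ) (n : ℤ) (z : ℂ) : ℂ :=
  (1 / Complex.I) * ((-1 : ℂ) ^ n *
    Complex.exp (-(s : ℂ) * ((n : ℂ) + 1 / 2) ^ 2) *
    Complex.exp (((n : ℂ) + 1 / 2) * Complex.I * z)) * (((n : ℂ) + 1 / 2) * Complex.I) ^ k

noncomputable def thS (k : ℕ) (s : ℝ) (z : ℂ) : ℂ := ∑' n : ℤ, thT k s n z

lemma Theta_eq (s : ℝ) (z : ℂ) : Theta s z = thS 0 s z := by
  simp only [Theta, thS, thT, pow_zero, mul_one, tsum_mul_left]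

noncomputable def thB (k : ℕ) (s R : ℝ) (n : ℤ) : ℝ :=
  |(n:ℝ) + 1/2| ^ k * Real.exp (-s * |(n:ℝ) + 1/2| ^ 2 + |(n:ℝ) + 1/2| * R)

lemma summable_exp_neg_abs : Summable (fun n : ℤ => Real.exp (-|(n:ℝ)|)) := by
  have h : Summable (fun n : ℕ => Real.exp (-(n:ℝ))) := Real.summable_exp_neg_nat
  apply Summable.of_nat_of_neg
  · simpa using h
  · simpa using h

lemma thB_summable (k : ℕ) {s : ℝ} (hs : 0 < s) (R : ℝ) : Summable (thB k s R) := by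
  refine Summable.of_nonneg_of_le (fun n => by unfold thB; positivity) (fun n => ?_)
    ((summable_exp_neg_abs).mul_left (k.factorial * Real.exp ((R + 2) ^ 2 / (4 * s) + 1 / 2)))
  unfold thB
  set m := |(n:ℝ) + 1/2| with hm
  have hm0 : 0 ≤ m := abs_nonneg _
  have h1 : m ^ k ≤ k.factorial * Real.exp m := by
    have := Real.pow_div_factorial_le_exp m hm0 k
    rw [div_le_iff₀ (by positivity)] at this
    linarith
  have h2 : |(n:ℝ)| ≤ m + 1/2 := by
    have : (n:ℝ) = (n + 1/2) - 1/2 := by ring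
    calc |(n:ℝ)| = |((n:ℝ) + 1/2) - 1/2| := by rw [← this]
      _ ≤ |(n:ℝ) + 1/2| + |1/2| := abs_sub _ _
      _ = m + 1/2 := by rw [abs_of_pos (by norm_num : (0:ℝ) < 1/2)]
  have h3 : -s * m ^ 2 + (R + 2) * m ≤ (R+2)^2 / (4*s) := by
    rw [le_div_iff₀ (by positivity)]
    nlinarith [sq_nonneg (2 * s * m - (R+2))]
  calc m ^ k * Real.exp (-s * m ^ 2 + m * R) ≤ (k.factorial * Real.exp m) * Real.exp (-s * m ^ 2 + m * R) := by gcongr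
    _ = k.factorial * Real.exp (m + (-s * m ^ 2 + m * R)) := by rw [Real.exp_add m]; ring
    _ ≤ k.factorial * Real.exp (((R + 2) ^ 2 / (4 * s) + 1 / 2) + (-|(n:ℝ)|)) := by
        apply mul_le_mul_of_nonneg_left _ (by positivity)
        apply Real.exp_le_exp.2
        nlinarith
    _ = _ := by rw [Real.exp_add (_ + _)]; ring

lemma thT_norm (k : ℕ) {s s0 R : ℝ} (hs : s0 ≤ s) (n : ℤ) {z : ℂ} (hz : |z.im| ≤ R) :
    ‖thT k s n z‖ ≤ thB k s0 R n := by
  have e1 : ((n : ℂ) + 1 / 2) = (((n:ℝ) + 1/2 : ℝ) : ℂ) := by push_cast; ring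
  unfold thT thB
  rw [e1]
  set m : ℝ := (n:ℝ) + 1/2
  have hn : ‖((-1 : ℂ) ^ n)‖ = 1 := by simp
  simp only [norm_mul, norm_pow, hn, Complex.norm_exp, Complex.norm_I, norm_div, norm_one, one_mul,
    mul_one, div_one]
  rw [Complex.norm_real, Real.norm_eq_abs, mul_comm, ← Real.exp_add]
  have e2 : (-(s:ℂ) * (m:ℂ)^2).re = -s * |m|^2 := by
    rw [sq_abs]; norm_cast
  have e3 : ((m:ℂ) * I * z).re = - m * z.im := by
    simp [Complex.mul_re]
  rw [e2, e3]
  have h1 : - m * z.im ≤ |m| * R := by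
    calc - m * z.im ≤ |-m * z.im| := le_abs_self _
      _ = |m| * |z.im| := by rw [abs_mul, abs_neg]
      _ ≤ _ := by gcongr
  have h2 : s0 * |m|^2 ≤ s * |m|^2 := by gcongr
  gcongr |m| ^ k * Real.exp ?_
  linarith

lemma thT_summable (k : ℕ) {s : ℝ} (hs : 0 < s) (z : ℂ) : Summable (fun n => thT k s n z) :=
  Summable.of_norm_bounded (thB_summable k hs |z.im|) (fun n => thT_norm k le_rfl n le_rfl)

lemma thT_hasDerivAt_z (k : ℕ) (s : ℝ) (n : ℤ) (z : ℂ) :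
    HasDerivAt (thT k s n) (thT (k+1) s n z) z := by
  unfold thT
  have h1 : HasDerivAt (fun z : ℂ => ((n : ℂ) + 1 / 2) * I * z) (((n : ℂ) + 1 / 2) * I) z := by
    simpa using (hasDerivAt_id z).const_mul (((n : ℂ) + 1 / 2) * I)
  have h := (((h1.cexp).const_mul ((-1 : ℂ) ^ n *
    Complex.exp (-(s : ℂ) * ((n : ℂ) + 1 / 2) ^ 2))).const_mul (1/I)).mul_const
      ((((n : ℂ) + 1 / 2) * Complex.I) ^ k)
  refine h.congr_deriv ?_
  ring

lemma thT_hasDerivAt_s (k : ℕ) (s : ℝ) (n : ℤ) (z : ℂ) :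
    HasDerivAt (fun s => thT k s n z) (thT (k+2) s n z) s := by
  unfold thT
  have h1 : HasDerivAt (fun s : ℝ => -(s:ℂ) * ((n : ℂ) + 1 / 2) ^ 2) (-((n : ℂ) + 1 / 2)^2) s := by
    simpa using (Complex.ofRealCLM.hasDerivAt (x := s)).neg.mul_const (((n : ℂ) + 1 / 2)^2)
  have h := ((((h1.cexp).const_mul ((-1 : ℂ) ^ n)).mul_const (cexp (((n : ℂ) + 1 / 2) * Complex.I * z))).const_mul (1/I)).mul_const
      ((((n : ℂ) + 1 / 2) * Complex.I) ^ k)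
  refine h.congr_deriv ?_
  rw [pow_add, mul_pow _ I 2, I_sq]
  ring

lemma thS_hasDerivAt_z (k : ℕ) {s : ℝ} (hs : 0 < s) (z : ℂ) :
    HasDerivAt (thS k s) (thS (k+1) s z) z := by
  have hopen : IsOpen {w : ℂ | |w.im| < |z.im| + 1} :=
    isOpen_lt (continuous_abs.comp Complex.continuous_im) continuous_const
  have hconv : Convex ℝ {w : ℂ | |w.im| < |z.im| + 1} := by
    have : {w : ℂ | |w.im| < |z.im| + 1} = Complex.imLm ⁻¹' (Set.Ioo (-(|z.im|+1)) (|z.im|+1)) := by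
      ext w; simp [abs_lt]
    rw [this]
    exact (convex_Ioo _ _).linear_preimage _
  have hz : z ∈ {w : ℂ | |w.im| < |z.im| + 1} := by simp
  exact hasDerivAt_tsum_of_isPreconnected (thB_summable (k+1) hs (|z.im|+1)) hopen
    hconv.isPreconnected (fun n y _ => thT_hasDerivAt_z k s n y)
    (fun n y hy => thT_norm (k+1) le_rfl n (le_of_lt hy)) hz (thT_summable k hs z) hz

lemma thS_hasDerivAt_s (k : ℕ) {s : ℝ} (hs : 0 < s) (z : ℂ) :
    HasDerivAt (fun s => thS k s z) (thS (k+2) s z) s := by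
  have hz : s ∈ Set.Ioi (s/2) := by simp [hs]
  exact hasDerivAt_tsum_of_isPreconnected (thB_summable (k+2) (half_pos hs) (|z.im|)) isOpen_Ioi
    isPreconnected_Ioi (fun n y _ => thT_hasDerivAt_s k y n z)
    (fun n y hy => thT_norm (k+2) (le_of_lt hy) n le_rfl) hz (thT_summable k hs z) hz

lemma thS_continuousAt (k : ℕ) {s : ℝ} (hs : 0 < s) (z : ℂ) :
    ContinuousAt (fun p : ℝ × ℂ => thS k p.1 p.2) (s, z) := by
  have hopen : IsOpen {p : ℝ × ℂ | s / 2 < p.1 ∧ |p.2.im| < |z.im| + 1} :=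
    (isOpen_lt continuous_const continuous_fst).inter
      (isOpen_lt (continuous_abs.comp (Complex.continuous_im.comp continuous_snd)) continuous_const)
  have : ContinuousOn (fun p : ℝ × ℂ => thS k p.1 p.2)
      {p : ℝ × ℂ | s / 2 < p.1 ∧ |p.2.im| < |z.im| + 1} := by
    refine continuousOn_tsum (fun n => ?_) (thB_summable k (half_pos hs) (|z.im|+1))
      (fun n p hp => thT_norm k (le_of_lt hp.1) n (le_of_lt hp.2))
    unfold thT
    fun_prop
  exact this.continuousAt (hopen.mem_nhds ⟨by simp [hs], by simp⟩)

lemma thS_differentiable (k : ℕ) {s : ℝ} (hs : 0 < s) : Differentiable ℂ (thS k s) :=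
  fun z => (thS_hasDerivAt_z k hs z).differentiableAt

lemma deriv_thS (k : ℕ) {s : ℝ} (hs : 0 < s) : deriv (thS k s) = thS (k+1) s :=
  funext fun z => (thS_hasDerivAt_z k hs z).deriv

lemma deriv_Theta {s : ℝ} (hs : 0 < s) : deriv (Theta s) = thS 1 s := by
  rw [show Theta s = thS 0 s from funext (Theta_eq s), deriv_thS 0 hs]

lemma thS_add_two_pi (k : ℕ) (s : ℝ) (z : ℂ) : thS k s (z + 2 * Real.pi) = - thS k s z := by
  unfold thS
  rw [← tsum_neg]
  congr 1; ext n
  unfold thT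
  have : cexp (((n:ℂ) + 1/2) * I * (z + 2 * Real.pi)) = - cexp (((n:ℂ) + 1/2) * I * z) := by
    rw [show ((n:ℂ) + 1/2) * I * (z + 2 * Real.pi) = ((n:ℂ) + 1/2) * I * z + (Real.pi * I + n * (2 * Real.pi * I)) by ring,
      Complex.exp_add, Complex.exp_add, Complex.exp_int_mul_two_pi_mul_I, Complex.exp_pi_mul_I]
    ring
  rw [this]; ring

lemma neg_one_zpow_refl (n : ℤ) : (-1 : ℂ) ^ (-1 - n) = - (-1) ^ n := by
  rw [zpow_sub₀ (by norm_num)]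
  rcases Int.even_or_odd n with h | h
  · rw [h.neg_one_zpow]; norm_num
  · rw [h.neg_one_zpow]; norm_num

lemma thS_neg (k : ℕ) (s : ℝ) (z : ℂ) : thS k s (-z) = (-1) ^ (k+1) * thS k s z := by
  unfold thS
  rw [← tsum_mul_left, ← (Equiv.subLeft (-1 : ℤ)).tsum_eq]
  congr 1; ext n
  simp only [Equiv.subLeft_apply, thT]
  rw [neg_one_zpow_refl]
  push_cast
  rw [show (-1 - (n:ℂ) + 1/2) = - ((n:ℂ) + 1/2) by ring, neg_sq, neg_mul ((n:ℂ) + 1/2) I, neg_mul_neg,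
    neg_pow (((n:ℂ) + 1/2) * I)]
  ring

lemma thS_conj (k : ℕ) (s : ℝ) (z : ℂ) : thS k s ((starRingEnd ℂ) z) = (starRingEnd ℂ) (thS k s z) := by
  unfold thS
  rw [Complex.conj_tsum, ← (Equiv.subLeft (-1 : ℤ)).tsum_eq]
  congr 1; ext n
  simp only [Equiv.subLeft_apply, thT]
  rw [neg_one_zpow_refl]
  simp only [map_mul, map_div₀, map_one, Complex.conj_I, map_zpow₀, map_neg, ← Complex.exp_conj,
    Complex.conj_ofReal, map_add, map_pow, map_intCast, map_ofNat]
  push_cast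
  rw [show (-1 - (n:ℂ) + 1/2) = - ((n:ℂ) + 1/2) by ring, neg_sq, mul_neg, neg_mul]
  simp only [neg_mul, mul_neg, div_neg]

lemma thS_real (k : ℕ) (s x : ℝ) : ((thS k s x).re : ℂ) = thS k s x := by
  apply Complex.conj_eq_iff_re.1
  rw [← thS_conj, Complex.conj_ofReal]

lemma thS0_add_quasi (s : ℝ) (z : ℂ) :
    thS 0 s (z + 2 * I * s) = - cexp (s - I * z) * thS 0 s z := by
  unfold thS
  rw [← tsum_mul_left]
  conv_rhs => rw [← (Equiv.addRight (1 : ℤ)).tsum_eq]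
  congr 1; ext n
  simp only [Equiv.coe_addRight, thT, pow_zero, mul_one]
  rw [zpow_add₀ (by norm_num)]
  have : cexp (-(s : ℂ) * ((n : ℂ) + 1 / 2) ^ 2) * cexp (((n : ℂ) + 1 / 2) * I * (z + 2 * I * s))
     = cexp (s - I * z) * (cexp (-(s : ℂ) * (((n + 1 : ℤ) : ℂ) + 1 / 2) ^ 2) * cexp ((((n+1 : ℤ) : ℂ) + 1 / 2) * I * z)) := by
    rw [← Complex.exp_add, ← Complex.exp_add, ← Complex.exp_add]
    congr 1
    push_cast
    linear_combination (2 * (n + 1/2) * s : ℂ) * I_sq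
  linear_combination (1 / I * (-1)^n) * this

open Complex

def fundDom (r : ℝ) : Set ℂ := Set.Icc (-Real.pi) Real.pi ×ℂ Set.Icc (-r) r

lemma fundDom_compact (r : ℝ) : IsCompact (fundDom r) := isCompact_Icc.reProdIm isCompact_Icc

lemma exists_round {p : ℝ} (hp : 0 < p) (x : ℝ) : ∃ n : ℤ, x - n * (2 * p) ∈ Set.Icc (-p) p := by
  refine ⟨round (x / (2 * p)), ?_⟩
  have h := abs_sub_round (x / (2*p))
  rw [abs_le] at h
  have e : x = x / (2 * p) * (2 * p) := by field_simp
  constructor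
  · nlinarith [h.1, h.2]
  · nlinarith [h.1, h.2]

lemma exists_fund {r : ℝ} (hr : 0 < r) (z : ℂ) :
    ∃ m n : ℤ, z - m * (2 * Real.pi) - n * (2 * I * r) ∈ fundDom r := by
  obtain ⟨m, hm⟩ := exists_round Real.pi_pos z.re
  obtain ⟨n, hn⟩ := exists_round hr z.im
  refine ⟨m, n, ?_⟩
  rw [fundDom, Complex.mem_reProdIm]
  constructor
  · simpa using hm
  · simpa using hn

lemma fund_induct {α : Type*} {r : ℝ} (hr : 0 < r) {f : ℂ → α} (h1 : Function.Periodic f (2 * Real.pi))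
    (h2 : Function.Periodic f (2 * I * r)) (z : ℂ) : ∃ w ∈ fundDom r, f z = f w := by
  obtain ⟨m, n, h⟩ := exists_fund hr z
  exact ⟨_, h, by rw [h2.sub_int_mul_eq, h1.sub_int_mul_eq]⟩

open Classical in
noncomputable def divQ (N D : ℂ → ℂ) (z : ℂ) : ℂ :=
  if D z = 0 then deriv N z / deriv D z else N z / D z

lemma deriv_shift {N m : ℂ → ℂ} {ω : ℂ} (hN : Differentiable ℂ N) (hm : Differentiable ℂ m)
    (h : ∀ z, N (z + ω) = m z * N z) (z : ℂ) :
    deriv N (z + ω) = deriv m z * N z + m z * deriv N z := by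
  have h1 : HasDerivAt (fun z => N (z + ω)) (deriv N (z+ω)) z :=
    (hN (z+ω)).hasDerivAt.comp_add_const z ω
  have h2 := (hm z).hasDerivAt.mul (hN z).hasDerivAt
  have e : (fun z => N (z + ω)) = m * N := funext h
  rw [e] at h1
  exact h1.unique h2

lemma good_periodic {N D m : ℂ → ℂ} {ω : ℂ} (_hN : Differentiable ℂ N) (hD : Differentiable ℂ D)
    (hm : Differentiable ℂ m) (hm0 : ∀ z, m z ≠ 0) (h : ∀ z, N (z + ω) = m z * N z)
    (h' : ∀ z, D (z + ω) = m z * D z) :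
    Function.Periodic (fun z => D z = 0 → N z = 0 ∧ deriv D z ≠ 0) ω := by
  intro z
  simp only [h, h', deriv_shift hD hm h' z, mul_eq_zero, hm0, false_or, eq_iff_iff]
  constructor
  · intro H hz
    have := H hz
    simpa [hz, hm0] using this
  · intro H hz
    have := H hz
    simpa [hz, hm0] using this

lemma divQ_periodic {N D m : ℂ → ℂ} {ω : ℂ} (hN : Differentiable ℂ N) (hD : Differentiable ℂ D)
    (hm : Differentiable ℂ m) (hm0 : ∀ z, m z ≠ 0) (h : ∀ z, N (z + ω) = m z * N z)
    (h' : ∀ z, D (z + ω) = m z * D z) (good : ∀ z, D z = 0 → N z = 0 ∧ deriv D z ≠ 0) :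
    Function.Periodic (divQ N D) ω := by
  intro z
  unfold divQ
  by_cases hz : D z = 0
  · have h3 := hm0 z
    rw [if_pos (by rw [h', hz, mul_zero]), if_pos hz, deriv_shift hD hm h' z, deriv_shift hN hm h z,
      hz, (good z hz).1, mul_zero, zero_add, zero_add, mul_div_mul_left _ _ h3]
  · rw [if_neg (by rw [h']; exact mul_ne_zero (hm0 z) hz), if_neg hz, h, h',
      mul_div_mul_left _ _ (hm0 z)]

lemma divQ_differentiable {N D : ℂ → ℂ} (hN : Differentiable ℂ N) (hD : Differentiable ℂ D)
    (good : ∀ z, D z = 0 → N z = 0 ∧ deriv D z ≠ 0) : Differentiable ℂ (divQ N D) := by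
  intro z0
  by_cases hz : D z0 = 0
  · obtain ⟨hN0, hD0⟩ := good z0 hz
    have dN : Differentiable ℂ (dslope N z0) := by
      rw [← differentiableOn_univ, Complex.differentiableOn_dslope Filter.univ_mem]
      exact hN.differentiableOn
    have dD : Differentiable ℂ (dslope D z0) := by
      rw [← differentiableOn_univ, Complex.differentiableOn_dslope Filter.univ_mem]
      exact hD.differentiableOn
    have hne : dslope D z0 z0 ≠ 0 := by rwa [dslope_same]
    have hq : DifferentiableAt ℂ (fun z => dslope N z0 z / dslope D z0 z) z0 :=
      (dN z0).div (dD z0) hne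
    refine hq.congr_of_eventuallyEq ?_
    filter_upwards [(dD z0).continuousAt.eventually_ne hne] with z hz'
    by_cases hzz : z = z0
    · subst hzz
      simp [divQ, hz, dslope_same]
    · have hs : z - z0 ≠ 0 := sub_ne_zero.2 hzz
      rw [dslope_of_ne _ hzz, slope_def_field, hz, sub_zero] at hz'
      have hDz : D z ≠ 0 := fun h => hz' (by rw [h, zero_div])
      rw [divQ, if_neg hDz, dslope_of_ne _ hzz, dslope_of_ne _ hzz, slope_def_field,
        slope_def_field, hz, hN0]
      field_simp
      ring
  · refine ((hN z0).div (hD z0) hz).congr_of_eventuallyEq ?_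
    filter_upwards [(hD z0).continuousAt.eventually_ne hz] with z hz'
    simp [divQ, hz']

lemma liouville_quot {r : ℝ} (hr : 0 < r) {N D m1 m2 : ℂ → ℂ} (hN : Differentiable ℂ N)
    (hD : Differentiable ℂ D) (hm1 : Differentiable ℂ m1) (hm10 : ∀ z, m1 z ≠ 0)
    (hm2 : Differentiable ℂ m2) (hm20 : ∀ z, m2 z ≠ 0)
    (hN1 : ∀ z, N (z + 2 * Real.pi) = m1 z * N z) (hD1 : ∀ z, D (z + 2 * Real.pi) = m1 z * D z)
    (hN2 : ∀ z, N (z + 2 * I * r) = m2 z * N z) (hD2 : ∀ z, D (z + 2 * I * r) = m2 z * D z)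
    (hg : ∀ z ∈ fundDom r, D z = 0 → N z = 0 ∧ deriv D z ≠ 0) :
    ∃ c, (∀ z, N z = c * D z) ∧ ∀ z, D z = 0 → deriv D z ≠ 0 := by
  have good : ∀ z, D z = 0 → N z = 0 ∧ deriv D z ≠ 0 := by
    intro z
    obtain ⟨w, hw, e⟩ := fund_induct hr (good_periodic hN hD hm1 hm10 hN1 hD1)
      (good_periodic hN hD hm2 hm20 hN2 hD2) z
    exact Eq.mpr e (hg w hw)
  have hQ := divQ_differentiable hN hD good
  have hb : Bornology.IsBounded (Set.range (divQ N D)) := by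
    have hc : IsCompact (divQ N D '' fundDom r) := (fundDom_compact r).image hQ.continuous
    refine hc.isBounded.subset ?_
    rintro _ ⟨z, rfl⟩
    obtain ⟨w, hw, e⟩ := fund_induct hr (divQ_periodic hN hD hm1 hm10 hN1 hD1 good)
      (divQ_periodic hN hD hm2 hm20 hN2 hD2 good) z
    exact ⟨w, hw, e.symm⟩
  refine ⟨divQ N D 0, fun z => ?_, fun z hz => (good z hz).2⟩
  rw [hQ.apply_eq_apply_of_bounded hb 0 z]
  unfold divQ
  by_cases hz : D z = 0
  · rw [hz, mul_zero, (good z hz).1]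
  · rw [if_neg hz]; field_simp

lemma liouville_const {r : ℝ} (hr : 0 < r) {N D m1 m2 : ℂ → ℂ} (hN : Differentiable ℂ N)
    (hD : Differentiable ℂ D) (hm1 : Differentiable ℂ m1) (hm10 : ∀ z, m1 z ≠ 0)
    (hm2 : Differentiable ℂ m2) (hm20 : ∀ z, m2 z ≠ 0)
    (hN1 : ∀ z, N (z + 2 * Real.pi) = m1 z * N z) (hD1 : ∀ z, D (z + 2 * Real.pi) = m1 z * D z)
    (hN2 : ∀ z, N (z + 2 * I * r) = m2 z * N z) (hD2 : ∀ z, D (z + 2 * I * r) = m2 z * D z)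
    (hg : ∀ z ∈ fundDom r, D z = 0 → N z = 0 ∧ deriv D z ≠ 0) :
    ∃ c, ∀ z, N z = c * D z := by
  obtain ⟨c, h, _⟩ := liouville_quot hr hN hD hm1 hm10 hm2 hm20 hN1 hD1 hN2 hD2 hg
  exact ⟨c, h⟩

open Complex

/-- q-product ∏ (1 - Q^(n+1) w). -/
noncomputable def qA (Q : ℝ) (w : ℂ) : ℂ := ∏' n : ℕ, (1 + -((Q:ℂ) ^ (n+1) * w))

lemma qA_summable {Q : ℝ} (h0 : 0 < Q) (h1 : Q < 1) (R : ℝ) :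
    Summable (fun n : ℕ => Q ^ (n+1) * R) :=
  ((summable_nat_add_iff 1).mpr (summable_geometric_of_lt_one h0.le h1)).mul_right R

lemma qA_norm {Q : ℝ} (h0 : 0 < Q) (n : ℕ) (w : ℂ) : ‖-((Q:ℂ) ^ (n+1) * w)‖ = Q ^ (n+1) * ‖w‖ := by
  rw [norm_neg, norm_mul, norm_pow, Complex.norm_real, Real.norm_of_nonneg h0.le]

lemma qA_mult {Q : ℝ} (h0 : 0 < Q) (h1 : Q < 1) (R : ℝ) :
    MultipliableLocallyUniformlyOn (fun (n : ℕ) (w : ℂ) => 1 + -((Q:ℂ) ^ (n+1) * w)) (Metric.ball 0 R) := by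
  refine Summable.multipliableLocallyUniformlyOn_nat_one_add Metric.isOpen_ball (qA_summable h0 h1 R)
    (Filter.Eventually.of_forall fun n w hw => ?_) (fun n => by fun_prop)
  rw [qA_norm h0]
  have : ‖w‖ < R := by simpa using hw
  gcongr

lemma qA_differentiable {Q : ℝ} (h0 : 0 < Q) (h1 : Q < 1) : Differentiable ℂ (qA Q) := by
  intro w
  have h : DifferentiableOn ℂ (fun w => ∏' n : ℕ, (1 + -((Q:ℂ) ^ (n+1) * w))) (Metric.ball 0 (‖w‖+1)) :=
    (qA_mult h0 h1 (‖w‖+1)).hasProdLocallyUniformlyOn.differentiableOn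
    (.of_forall fun _ ↦ by simpa [Finset.prod_fn] using
      DifferentiableOn.finsetProd (fun _ _ ↦ by fun_prop)) Metric.isOpen_ball
  exact h.differentiableAt (Metric.isOpen_ball.mem_nhds (by simp))

lemma qA_multipliable {Q : ℝ} (h0 : 0 < Q) (h1 : Q < 1) (w : ℂ) :
    Multipliable (fun n : ℕ => (1 + -((Q:ℂ) ^ (n+1) * w))) := by
  apply multipliable_one_add_of_summable
  simp_rw [qA_norm h0]
  exact qA_summable h0 h1 _

lemma qA_ne_zero {Q : ℝ} (h0 : 0 < Q) (h1 : Q < 1) {w : ℂ} (hw : ‖w‖ * Q < 1) : qA Q w ≠ 0 := by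
  refine tprod_one_add_ne_zero_of_summable (f := fun n : ℕ => -((Q:ℂ) ^ (n+1) * w)) ?_ ?_
  · intro n h
    have h2 : ‖-((Q:ℂ) ^ (n+1) * w)‖ = 1 := by
      rw [eq_neg_of_add_eq_zero_right h]; simp
    rw [qA_norm h0] at h2
    have : Q ^ (n+1) ≤ Q := pow_le_of_le_one h0.le h1.le (by omega)
    nlinarith [norm_nonneg w, mul_le_mul_of_nonneg_right this (norm_nonneg w)]
  · simp_rw [qA_norm h0]
    exact qA_summable h0 h1 _

lemma qA_shift {Q : ℝ} (h0 : 0 < Q) (h1 : Q < 1) (w : ℂ) :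
    qA Q w = (1 - Q * w) * qA Q (Q * w) := by
  have e : ∀ n : ℕ, 1 + -((Q:ℂ) ^ (n+1+1) * w) = 1 + -((Q:ℂ) ^ (n+1) * (Q * w)) := fun n => by ring
  have hm : Multipliable (fun n : ℕ => 1 + -((Q:ℂ) ^ (n+1+1) * w)) := by
    simp_rw [e]; exact qA_multipliable h0 h1 _
  have h := tprod_eq_zero_mul' (f := fun n : ℕ => 1 + -((Q:ℂ) ^ (n+1) * w)) hm
  unfold qA
  rw [h]
  simp_rw [e]
  congr 1
  ring

lemma qA_conj {Q : ℝ} (h0 : 0 < Q) (h1 : Q < 1) (w : ℂ) :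
    qA Q ((starRingEnd ℂ) w) = (starRingEnd ℂ) (qA Q w) := by
  unfold qA
  rw [(qA_multipliable h0 h1 w).map_tprod (starRingEnd ℂ) Complex.continuous_conj]
  congr 1; ext n
  simp

/-- The product form of the theta function, without the constant. -/
noncomputable def thP (r : ℝ) (z : ℂ) : ℂ :=
  sin (z / 2) * (qA (Real.exp (-2 * r)) (cexp (I * z)) * qA (Real.exp (-2 * r)) (cexp (-(I * z))))

lemma Q_lt {r : ℝ} (hr : 0 < r) : Real.exp (-2 * r) < 1 := by
  rw [Real.exp_lt_one_iff]; linarith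
lemma Q_pos (r : ℝ) : 0 < Real.exp (-2 * r) := Real.exp_pos _

lemma thP_differentiable {r : ℝ} (hr : 0 < r) : Differentiable ℂ (thP r) := by
  have h := qA_differentiable (Q_pos r) (Q_lt hr)
  unfold thP
  fun_prop

lemma thP_two_pi (r : ℝ) (z : ℂ) : thP r (z + 2 * Real.pi) = -1 * thP r z := by
  unfold thP
  have e1 : cexp (I * (z + 2 * Real.pi)) = cexp (I * z) := by
    rw [show I * (z + 2 * Real.pi) = I * z + 2 * Real.pi * I by ring, Complex.exp_add,
      Complex.exp_two_pi_mul_I, mul_one]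
  have e2 : cexp (-(I * (z + 2 * Real.pi))) = cexp (-(I * z)) := by
    rw [Complex.exp_neg, e1, ← Complex.exp_neg]
  rw [e1, e2, show (z + 2 * Real.pi) / 2 = z / 2 + Real.pi by ring, Complex.sin_add_pi]
  ring

lemma thP_quasi {r : ℝ} (hr : 0 < r) (z : ℂ) :
    thP r (z + 2 * I * r) = - cexp (r - I * z) * thP r z := by
  unfold thP
  set Q := Real.exp (-2 * r) with hQ
  have hQ' : (Q : ℂ) = cexp (-2 * r) := by rw [hQ]; push_cast; rfl
  have e1 : cexp (I * (z + 2 * I * r)) = Q * cexp (I * z) := by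
    rw [hQ', ← Complex.exp_add]; congr 1; linear_combination (2 * r : ℂ) * I_sq
  have e2 : cexp (-(I * z)) = Q * cexp (-(I * (z + 2 * I * r))) := by
    rw [hQ', ← Complex.exp_add]; congr 1; linear_combination (2 * r : ℂ) * I_sq
  have h1 := qA_shift (Q_pos r) (Q_lt hr) (cexp (I * z))
  have h2 := qA_shift (Q_pos r) (Q_lt hr) (cexp (-(I * (z + 2 * I * r))))
  rw [← hQ, ← e1] at h1
  rw [← hQ, ← e2] at h2
  rw [h1, h2]
  have e3 : sin ((z + 2 * I * r) / 2) * (1 - cexp (-(I * z))) =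
     - cexp (r - I * z) * (sin (z / 2) * (1 - cexp (I * (z + 2 * I * r)))) := by
    rw [Complex.sin, Complex.sin]
    rw [show -((z + 2 * I * r) / 2) * I = r - z/2 * I by linear_combination (-r : ℂ) * I_sq,
      show ((z + 2 * I * r) / 2) * I = - r + z/2 * I by linear_combination (r : ℂ) * I_sq,
      show I * (z + 2 * I * r) = z / 2 * I + z/2*I - r - r by linear_combination (2 * r : ℂ) * I_sq,
      show -(I * z) = - (z/2 * I) - z/2 * I by ring,
      show r - I * z = r - z/2 * I - z/2 * I by ring, show - (z/2) * I = - (z/2 * I) by ring]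
    simp only [Complex.exp_sub, Complex.exp_add, Complex.exp_neg]
    have := Complex.exp_ne_zero (z/2 * I)
    have := Complex.exp_ne_zero r
    field_simp
    ring
  linear_combination (qA Q (cexp (I * (z + 2 * I * ↑r))) * qA Q (cexp (-(I * z)))) * e3

lemma thP_zero_fund {r : ℝ} (hr : 0 < r) {z : ℂ} (hz : z ∈ fundDom r) (h : thP r z = 0) : z = 0 := by
  rw [fundDom, Complex.mem_reProdIm] at hz
  obtain ⟨⟨a1, a2⟩, b1, b2⟩ := hz
  have key : ∀ w : ℂ, |w.re| ≤ r → ‖cexp w‖ * Real.exp (-2 * r) < 1 := by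
    intro w hw
    rw [Complex.norm_exp, ← Real.exp_add, Real.exp_lt_one_iff]
    linarith [(abs_le.1 hw).2]
  have n1 := qA_ne_zero (Q_pos r) (Q_lt hr) (key (I * z) (by rw [abs_le]; constructor <;> simp <;> linarith))
  have n2 := qA_ne_zero (Q_pos r) (Q_lt hr) (key (-(I * z)) (by rw [abs_le]; constructor <;> simp <;> linarith))
  have hs : sin (z / 2) = 0 := by
    rw [thP] at h
    exact (mul_eq_zero.1 h).resolve_right (mul_ne_zero n1 n2)
  rw [Complex.sin_eq_zero_iff] at hs
  obtain ⟨k, hk⟩ := hs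
  have hk' : z = ((2 * k * Real.pi : ℝ) : ℂ) := by
    push_cast; linear_combination 2 * hk
  have hre : z.re = 2 * k * Real.pi := by rw [hk', Complex.ofReal_re]
  have hk0 : k = 0 := by
    rw [hre] at a1 a2
    have c1 : (k:ℝ) < 1 := by nlinarith [Real.pi_pos]
    have c2 : (-1:ℝ) < k := by nlinarith [Real.pi_pos]
    have c1' : k < 1 := by exact_mod_cast c1
    have c2' : -1 < k := by exact_mod_cast c2
    omega
  rw [hk', hk0]; simp

lemma thP_deriv_zero {r : ℝ} (hr : 0 < r) : deriv (thP r) 0 = qA (Real.exp (-2*r)) 1 ^ 2 / 2 := by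
  have h := qA_differentiable (Q_pos r) (Q_lt hr)
  set B : ℂ → ℂ := fun z => (qA (Real.exp (-2 * r)) (cexp (I * z)) * qA (Real.exp (-2 * r)) (cexp (-(I * z)))) with hB
  have hBd : Differentiable ℂ B := by rw [hB]; fun_prop
  have h1 : HasDerivAt (fun z : ℂ => sin (z / 2)) (cos (0/2) * (1/2)) 0 :=
    ((hasDerivAt_id (0:ℂ)).div_const 2).csin
  have h2 := (h1.mul (hBd 0).hasDerivAt).deriv
  rw [show thP r = (fun z : ℂ => sin (z / 2)) * B from rfl, h2, hB]
  simp
  ring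

lemma qA_one_ne_zero {r : ℝ} (hr : 0 < r) : qA (Real.exp (-2*r)) 1 ≠ 0 :=
  qA_ne_zero (Q_pos r) (Q_lt hr) (by rw [norm_one, one_mul]; exact Q_lt hr)

lemma thS0_zero (k : ℕ) (r : ℝ) : thS (2*k) r 0 = 0 := by
  have := thS_neg (2*k) r 0
  rw [neg_zero, pow_add, pow_mul] at this
  norm_num at this
  linear_combination this / 2

lemma exists_thP {r : ℝ} (hr : 0 < r) :
    ∃ c, (∀ z, thS 0 r z = c * thP r z) ∧ ∀ z, thP r z = 0 → deriv (thP r) z ≠ 0 := by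
  refine liouville_quot hr (m1 := fun _ => -1) (m2 := fun z => - cexp (r - I * z))
    (thS_differentiable 0 hr) (thP_differentiable hr) (by fun_prop) (by simp) (by fun_prop)
    (by simp [Complex.exp_ne_zero])
    (fun z => by rw [thS_add_two_pi]; ring) (thP_two_pi r) (thS0_add_quasi r) (thP_quasi hr) ?_
  intro z hz h
  have := thP_zero_fund hr hz h
  subst this
  refine ⟨thS0_zero 0 r, ?_⟩
  rw [thP_deriv_zero hr]
  exact div_ne_zero (pow_ne_zero _ (qA_one_ne_zero hr)) two_ne_zero

lemma thP_real {r : ℝ} (hr : 0 < r) (x : ℝ) : thP r x =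
    ((Real.sin (x/2) * Complex.normSq (qA (Real.exp (-2 * r)) (cexp (I * x))) : ℝ) : ℂ) := by
  unfold thP
  have : cexp (-(I * x)) = (starRingEnd ℂ) (cexp (I * x)) := by
    rw [← Complex.exp_conj]; simp
  rw [this, qA_conj (Q_pos r) (Q_lt hr), Complex.mul_conj]
  push_cast; rfl

lemma thP_pos {r : ℝ} (hr : 0 < r) {x : ℝ} (hx : x ∈ Set.Ioo 0 (2 * Real.pi)) :
    0 < Real.sin (x/2) * Complex.normSq (qA (Real.exp (-2 * r)) (cexp (I * x))) := by
  apply mul_pos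
  · exact Real.sin_pos_of_pos_of_lt_pi (by linarith [hx.1]) (by linarith [hx.2])
  · rw [Complex.normSq_pos]
    apply qA_ne_zero (Q_pos r) (Q_lt hr)
    rw [Complex.norm_exp]
    simpa using hr

lemma thS0_pi_pos {r : ℝ} (hr : 0 < r) : 0 < (thS 0 r (Real.pi : ℝ)).re := by
  have hsum := thT_summable 0 hr (Real.pi : ℂ)
  have e : ∀ n : ℤ, thT 0 r n (Real.pi : ℝ) = ((Real.exp (-r * (n + 1/2)^2) : ℝ) : ℂ) := by
    intro n
    unfold thT
    rw [show ((n:ℂ) + 1/2) * I * (Real.pi : ℝ) = n * (Real.pi * I) + Real.pi / 2 * I by push_cast; ring,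
      Complex.exp_add, Complex.exp_int_mul, Complex.exp_pi_mul_I, Complex.exp_pi_div_two_mul_I]
    push_cast
    have : ((-1:ℂ)^n) * (-1)^n = 1 := by rw [← mul_zpow]; simp
    field_simp
    linear_combination this
  unfold thS
  rw [Complex.re_tsum hsum]
  simp_rw [e, Complex.ofReal_re]
  refine Summable.tsum_pos ?_ (fun n => (Real.exp_pos _).le) 0 (Real.exp_pos _)
  have := (Complex.reCLM.summable hsum)
  simpa only [Function.comp_def, Complex.reCLM_apply, e, Complex.ofReal_re] using this

lemma thS_c_pos {r : ℝ} (hr : 0 < r) : ∃ c : ℝ, 0 < c ∧ (∀ z, thS 0 r z = c * thP r z) ∧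
    ∀ z, thP r z = 0 → deriv (thP r) z ≠ 0 := by
  obtain ⟨c, hc, hd⟩ := exists_thP hr
  have h := thS0_pi_pos hr
  have h1 := hc Real.pi
  have h2 := thP_pos hr (x := Real.pi) ⟨Real.pi_pos, by linarith [Real.pi_pos]⟩
  rw [← thS_real, thP_real hr] at h1
  set p := Real.sin (Real.pi/2) * Complex.normSq (qA (Real.exp (-2 * r)) (cexp (I * Real.pi)))
  have hcr : c = (((thS 0 r (Real.pi : ℝ)).re / p : ℝ) : ℂ) := by
    push_cast
    rw [h1]
    have : (p : ℂ) ≠ 0 := by exact_mod_cast h2.ne'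
    field_simp
  exact ⟨_, div_pos h h2, by rw [← hcr]; exact hc, hd⟩

lemma thS0_pos {r : ℝ} (hr : 0 < r) {x : ℝ} (hx : x ∈ Set.Ioo 0 (2 * Real.pi)) :
    0 < (thS 0 r x).re := by
  obtain ⟨c, hc, h, _⟩ := thS_c_pos hr
  rw [h, thP_real hr, ← Complex.ofReal_mul, Complex.ofReal_re]
  exact mul_pos hc (thP_pos hr hx)

lemma thS1_zero_pos {r : ℝ} (hr : 0 < r) : 0 < (thS 1 r 0).re := by
  obtain ⟨c, hc, h, _⟩ := thS_c_pos hr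
  have e : thS 0 r = fun z => c * thP r z := funext h
  have h1 : thS 1 r 0 = c * deriv (thP r) 0 := by
    rw [← deriv_thS 0 hr, e, deriv_const_mul_field]
  have h2 : (qA (Real.exp (-2*r)) 1) = ((qA (Real.exp (-2*r)) 1).re : ℂ) := by
    symm; rw [← Complex.conj_eq_iff_re, ← qA_conj (Q_pos r) (Q_lt hr)]; simp
  rw [h1, thP_deriv_zero hr, h2]
  have h3 : (qA (Real.exp (-2*r)) 1).re ≠ 0 := by
    intro h0; rw [h0] at h2; exact qA_one_ne_zero hr (by simpa using h2)
  have h4 : 0 < (qA (Real.exp (-2*r)) 1).re ^ 2 := by positivity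
  have h5 : 0 < c * ((qA (Real.exp (-2*r)) 1).re ^ 2 / 2) := by positivity
  exact_mod_cast h5

lemma thS0_simple {r : ℝ} (hr : 0 < r) {z : ℂ} (hz : thS 0 r z = 0) : thS 1 r z ≠ 0 := by
  obtain ⟨c, hc, h, hd⟩ := thS_c_pos hr
  have e : thS 0 r = fun z => c * thP r z := funext h
  have hc' : (c:ℂ) ≠ 0 := by exact_mod_cast hc.ne'
  have h1 : thS 1 r z = c * deriv (thP r) z := by
    rw [← deriv_thS 0 hr, e, deriv_const_mul_field]
  rw [h1]
  rw [h] at hz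
  exact mul_ne_zero hc' (hd z (by simpa [hc'] using hz))

lemma thS0_zero_fund {r : ℝ} (hr : 0 < r) {z : ℂ} (hz : z ∈ fundDom r) (h : thS 0 r z = 0) : z = 0 := by
  obtain ⟨c, hc, h', hd⟩ := thS_c_pos hr
  have hc' : (c:ℂ) ≠ 0 := by exact_mod_cast hc.ne'
  rw [h'] at h
  exact thP_zero_fund hr hz (by simpa [hc'] using h)

open Complex

lemma thS1_add_quasi {r : ℝ} (hr : 0 < r) (z : ℂ) :
    thS 1 r (z + 2 * I * r) = - cexp (r - I * z) * (thS 1 r z - I * thS 0 r z) := by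
  have hm : ∀ z : ℂ, HasDerivAt (fun z : ℂ => - cexp (r - I * z)) (- (cexp (r - I * z) * (-I))) z := by
    intro z
    have h1 : HasDerivAt (fun z : ℂ => (r:ℂ) - I * z) (-I) z := by
      simpa using ((hasDerivAt_id z).const_mul I).const_sub (r:ℂ)
    exact h1.cexp.neg
  have := deriv_shift (thS_differentiable 0 hr) (fun z => (hm z).differentiableAt) (thS0_add_quasi r) z
  rw [(hm z).deriv, deriv_thS 0 hr] at this
  rw [this]; ring

lemma thS2_add_quasi {r : ℝ} (hr : 0 < r) (z : ℂ) :
    thS 2 r (z + 2 * I * r) = - cexp (r - I * z) * (thS 2 r z - 2 * I * thS 1 r z - thS 0 r z) := by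
  have hm : HasDerivAt (fun z : ℂ => - cexp (r - I * z)) (- (cexp (r - I * z) * (-I))) z := by
    have h1 : HasDerivAt (fun z : ℂ => (r:ℂ) - I * z) (-I) z := by
      simpa using ((hasDerivAt_id z).const_mul I).const_sub (r:ℂ)
    exact h1.cexp.neg
  have h1 : HasDerivAt (fun z => thS 1 r (z + 2 * I * r)) (thS 2 r (z + 2 * I * r)) z :=
    (thS_hasDerivAt_z 1 hr _).comp_add_const z _
  have h2 := hm.mul ((thS_hasDerivAt_z 1 hr z).sub ((thS_hasDerivAt_z 0 hr z).const_mul I))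
  rw [show (fun z => thS 1 r (z + 2 * I * r)) = _ from funext (thS1_add_quasi hr)] at h1
  have h3 := h1.unique h2
  rw [h3]
  simp only [Nat.reduceAdd, Pi.sub_apply, zero_add]
  linear_combination (-cexp (r - I * z) * thS 0 r z) * I_sq

noncomputable def thE (r : ℝ) (t u : ℂ) : ℂ :=
  thS 2 r (u + t) * thS 0 r u * thS 0 r t + thS 0 r (u + t) * thS 2 r u * thS 0 r t
  + thS 0 r (u + t) * thS 0 r u * thS 2 r t + 2 * thS 0 r (u + t) * thS 1 r u * thS 1 r t
  - 2 * thS 1 r (u + t) * thS 1 r u * thS 0 r t - 2 * thS 1 r (u + t) * thS 0 r u * thS 1 r t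
  - (thS 3 r 0 / thS 1 r 0) * thS 0 r (u + t) * thS 0 r u * thS 0 r t

lemma thS1_zero_ne {r : ℝ} (hr : 0 < r) : thS 1 r 0 ≠ 0 := by
  intro h
  have := thS1_zero_pos hr
  rw [h] at this
  simp at this

lemma thE_deriv_zero {r : ℝ} (hr : 0 < r) (t : ℂ) : HasDerivAt (thE r t) 0 0 := by
  have hx : ∀ k, HasDerivAt (fun u => thS k r (u + t)) (thS (k+1) r (0 + t)) 0 := fun k =>
    (thS_hasDerivAt_z k hr _).comp_add_const 0 t
  have hu : ∀ k, HasDerivAt (thS k r) (thS (k+1) r 0) 0 := fun k => thS_hasDerivAt_z k hr 0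
  have h := ((((((((hx 2).mul (hu 0)).mul_const (thS 0 r t)).add (((hx 0).mul (hu 2)).mul_const (thS 0 r t))).add
    (((hx 0).mul (hu 0)).mul_const (thS 2 r t))).add
    ((((hx 0).const_mul 2).mul (hu 1)).mul_const (thS 1 r t))).sub
    ((((hx 1).const_mul 2).mul (hu 1)).mul_const (thS 0 r t))).sub
    ((((hx 1).const_mul 2).mul (hu 0)).mul_const (thS 1 r t))).sub
    ((((hx 0).const_mul (thS 3 r 0 / thS 1 r 0)).mul (hu 0)).mul_const (thS 0 r t))
  refine HasDerivAt.congr_deriv h ?_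
  have h0 := thS0_zero 0 r
  have h2 := thS0_zero 1 r
  simp only [mul_zero, mul_one] at h0 h2
  have h1 := thS1_zero_ne hr
  simp only [zero_add, Nat.reduceAdd, h0, h2]
  field_simp
  ring

lemma thE_eq_zero {r : ℝ} (hr : 0 < r) {t : ℝ} (ht : t ∈ Set.Ioo 0 (2 * Real.pi)) (u : ℂ) :
    thE r t u = 0 := by
  have ht0 : thS 0 r t ≠ 0 := by
    intro h; have := thS0_pos hr ht; rw [h] at this; simp at this
  have d : ∀ k, Differentiable ℂ (thS k r) := fun k => thS_differentiable k hr
  have dE : Differentiable ℂ (thE r t) := by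
    have d0 := d 0; have d1 := d 1; have d2 := d 2
    unfold thE
    fun_prop
  have dD : Differentiable ℂ (fun u => thS 0 r u * thS 0 r (u + t)) := by
    have d0 := d 0
    fun_prop
  have h0 := thS0_zero 0 r
  have h2 := thS0_zero 1 r
  simp only [mul_zero, mul_one] at h0 h2
  have hDd : ∀ u, HasDerivAt (fun u => thS 0 r u * thS 0 r (u + t))
      (thS 1 r u * thS 0 r (u + t) + thS 0 r u * thS 1 r (u + t)) u := fun u =>
    (thS_hasDerivAt_z 0 hr u).mul ((thS_hasDerivAt_z 0 hr _).comp_add_const u (t:ℂ))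
  have hE2pi : ∀ z, thE r t (z + 2 * Real.pi) = 1 * thE r t z := by
    intro z
    unfold thE
    rw [show z + 2 * Real.pi + t = (z + t) + 2 * Real.pi by ring]
    simp only [thS_add_two_pi]
    ring
  have hEz : thE r t 0 = 0 := by
    unfold thE
    rw [zero_add, h0, h2]; ring
  have hEt : thE r t (-t) = 0 := by
    unfold thE
    rw [neg_add_cancel, h0, h2, thS_neg 0 r t, thS_neg 1 r t, thS_neg 2 r t]; ring
  obtain ⟨c, hc⟩ := liouville_const hr (N := thE r t) (D := fun u => thS 0 r u * thS 0 r (u + t))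
    (m1 := fun _ => 1) (m2 := fun z => cexp (r - I * z) * cexp (r - I * (z + t))) dE dD
    (by fun_prop) (by simp) (by fun_prop) (by simp [Complex.exp_ne_zero]) hE2pi
    (fun z => by
      rw [show z + 2 * Real.pi + t = (z + t) + 2 * Real.pi by ring]
      simp only [thS_add_two_pi]
      ring)
    (fun z => by
      unfold thE
      rw [show z + 2 * I * r + t = (z + t) + 2 * I * r by ring]
      rw [thS0_add_quasi r z, thS0_add_quasi r (z+t), thS1_add_quasi hr z, thS1_add_quasi hr (z+t),
        thS2_add_quasi hr z, thS2_add_quasi hr (z+t)]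
      ring_nf
      simp only [I_sq]
      ring)
    (fun z => by
      rw [show z + 2 * I * r + t = (z + t) + 2 * I * r by ring]
      rw [thS0_add_quasi r z, thS0_add_quasi r (z+t)]
      ring)
    (by
      intro z hz h
      rw [(hDd z).deriv]
      rcases mul_eq_zero.1 h with h' | h'
      · have := thS0_zero_fund hr hz h'
        subst this
        refine ⟨hEz, ?_⟩
        rw [h', zero_add, zero_mul, add_zero]
        exact mul_ne_zero (thS1_zero_ne hr) ht0
      · have hs : thS 1 r (z + t) ≠ 0 := thS0_simple hr h'
        have hz2 : z = -t ∨ z = -t + 2 * Real.pi := by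
          have hz' := hz
          rw [fundDom, Complex.mem_reProdIm] at hz'
          obtain ⟨⟨a1, a2⟩, b1, b2⟩ := hz'
          by_cases hle : z.re + t ≤ Real.pi
          · left
            have : z + t = 0 := thS0_zero_fund hr (by
              rw [fundDom, Complex.mem_reProdIm]
              refine ⟨⟨?_, ?_⟩, ?_, ?_⟩ <;> simp <;> linarith [ht.1]) h'
            linear_combination this
          · right
            have h'' : thS 0 r (z + t - 2 * Real.pi) = 0 := by
              have := thS_add_two_pi 0 r (z + t - 2 * Real.pi)
              rw [sub_add_cancel, h'] at this
              linear_combination this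
            have : z + t - 2 * Real.pi = 0 := thS0_zero_fund hr (by
              rw [fundDom, Complex.mem_reProdIm]
              refine ⟨⟨?_, ?_⟩, ?_, ?_⟩ <;> simp <;> linarith [ht.2]) h''
            linear_combination this
        have hzE : thE r t z = 0 := by
          rcases hz2 with e | e
          · rw [e, hEt]
          · rw [e, hE2pi, hEt, mul_zero]
        have hz0 : thS 0 r z ≠ 0 := by
          rcases hz2 with e | e
          · rw [e, thS_neg]; simpa using ht0
          · rw [e, thS_add_two_pi, thS_neg]; simpa using ht0
        refine ⟨hzE, ?_⟩
        rw [h', mul_zero, zero_add]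
        exact mul_ne_zero hz0 hs)
  have e1 : HasDerivAt (thE r t) (c * (thS 1 r 0 * thS 0 r (0 + t) + thS 0 r 0 * thS 1 r (0 + t))) 0 := by
    rw [show thE r t = _ from funext hc]
    exact (hDd 0).const_mul c
  have e2 := e1.unique (thE_deriv_zero hr t)
  rw [h0, zero_mul, add_zero, zero_add] at e2
  have hc0 : c = 0 := by simpa [thS1_zero_ne hr, ht0] using e2
  rw [hc, hc0, zero_mul]

open Complex

lemma qA_aux {Q : ℝ} (h0 : 0 < Q) (h1 : Q < 1) {w : ℂ} (hw : w ∈ Metric.ball (0:ℂ) ((1+1/Q)/2)) (n : ℕ) :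
    (1 - Q)/2 ≤ ‖1 + -((Q:ℂ)^(n+1) * w)‖ ∧ ‖w‖ * Q < 1 := by
  have hw' : ‖w‖ < (1+1/Q)/2 := by simpa using hw
  have h2 : ‖w‖ * Q < (1 + Q)/2 := by
    have : (1+1/Q)/2 * Q = (1+Q)/2 := by field_simp; ring
    rw [← this]; gcongr
  have h3 : Q ^ (n+1) ≤ Q := pow_le_of_le_one h0.le h1.le (by omega)
  have h4 : ‖-((Q:ℂ) ^ (n+1) * w)‖ ≤ (1+Q)/2 := by
    rw [qA_norm h0]
    nlinarith [norm_nonneg w, mul_le_mul_of_nonneg_right h3 (norm_nonneg w)]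
  constructor
  · have := norm_sub_norm_le (1:ℂ) (((Q:ℂ) ^ (n+1) * w))
    rw [norm_neg] at h4
    rw [norm_one] at this
    rw [← sub_eq_add_neg]
    linarith
  · linarith

lemma qA_fac_ne {Q : ℝ} (h0 : 0 < Q) (h1 : Q < 1) {w : ℂ} (hw : w ∈ Metric.ball (0:ℂ) ((1+1/Q)/2)) (n : ℕ) :
    1 + -((Q:ℂ)^(n+1) * w) ≠ 0 := by
  intro h
  have := (qA_aux h0 h1 hw n).1
  rw [h, norm_zero] at this
  linarith

lemma qA_one_mem {Q : ℝ} (h0 : 0 < Q) (h1 : Q < 1) : (1:ℂ) ∈ Metric.ball (0:ℂ) ((1+1/Q)/2) := by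
  have : 1 < 1/Q := by rw [lt_div_iff₀ h0]; linarith
  simp only [mem_ball_zero_iff, norm_one]
  linarith

lemma qA_logDeriv {Q : ℝ} (h0 : 0 < Q) (h1 : Q < 1) {w : ℂ} (hw : w ∈ Metric.ball (0:ℂ) ((1+1/Q)/2)) :
    w * deriv (qA Q) w / qA Q w = ∑' n : ℕ, -((Q:ℂ)^(n+1) * w) / (1 + -((Q:ℂ)^(n+1) * w)) := by
  have hd : ∀ (n : ℕ) (w : ℂ), HasDerivAt (fun w : ℂ => 1 + -((Q:ℂ)^(n+1) * w)) (-((Q:ℂ)^(n+1))) w := by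
    intro n w
    simpa using ((((hasDerivAt_id w).const_mul ((Q:ℂ)^(n+1))).neg).const_add 1)
  have hl : ∀ n : ℕ, logDeriv (fun w : ℂ => 1 + -((Q:ℂ)^(n+1) * w)) w = -((Q:ℂ)^(n+1)) / (1 + -((Q:ℂ)^(n+1) * w)) := by
    intro n; rw [logDeriv_apply, (hd n w).deriv]
  have hsum : Summable (fun n : ℕ => -((Q:ℂ)^(n+1)) / (1 + -((Q:ℂ)^(n+1) * w))) := by
    refine Summable.of_norm_bounded (qA_summable h0 h1 (2/(1-Q))) fun n => ?_
    rw [norm_div, norm_neg, norm_pow, Complex.norm_real, Real.norm_of_nonneg h0.le]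
    have := (qA_aux h0 h1 hw n).1
    rw [div_eq_mul_inv]
    gcongr
    rw [show 2/(1-Q) = ((1-Q)/2)⁻¹ by rw [inv_div]]
    gcongr
  have h := logDeriv_tprod_eq_tsum (f := fun (n:ℕ) (w : ℂ) => 1 + -((Q:ℂ)^(n+1) * w)) Metric.isOpen_ball hw
    (fun n => qA_fac_ne h0 h1 hw n) (fun n w _ => (hd n w).differentiableAt.differentiableWithinAt)
    (by simp_rw [hl]; exact hsum) (qA_mult h0 h1 _) (qA_ne_zero h0 h1 (qA_aux h0 h1 hw 0).2)
  simp_rw [hl] at h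
  have h' : logDeriv (qA Q) w = _ := h
  rw [logDeriv_apply] at h'
  rw [mul_div_assoc, h', ← tsum_mul_left]
  congr 1; ext n; ring

lemma qA_logDeriv2 {Q : ℝ} (h0 : 0 < Q) (h1 : Q < 1) :
    HasDerivAt (fun w => w * deriv (qA Q) w / qA Q w) (-∑' n : ℕ, (Q:ℂ)^(n+1) / (1 - (Q:ℂ)^(n+1))^2) 1 := by
  have hm := qA_one_mem h0 h1
  have key : HasDerivAt (fun w => ∑' n : ℕ, -((Q:ℂ)^(n+1) * w) / (1 + -((Q:ℂ)^(n+1) * w)))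
      (∑' n : ℕ, -((Q:ℂ)^(n+1)) / (1 + -((Q:ℂ)^(n+1) * 1))^2) 1 := by
    refine hasDerivAt_tsum_of_isPreconnected (g' := fun n w => -((Q:ℂ)^(n+1)) / (1 + -((Q:ℂ)^(n+1) * w))^2)
      (t := Metric.ball (0:ℂ) ((1+1/Q)/2)) (y₀ := 0)
      (qA_summable h0 h1 ((2/(1-Q))^2)) Metric.isOpen_ball
      (convex_ball _ _).isPreconnected ?_ ?_ ?_ ?_ hm
    · intro n w hw
      have hne := qA_fac_ne h0 h1 hw n
      have hn : HasDerivAt (fun w : ℂ => -((Q:ℂ)^(n+1) * w)) (-((Q:ℂ)^(n+1))) w := by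
        exact (((hasDerivAt_id w).const_mul ((Q:ℂ)^(n+1))).neg).congr_deriv (by simp)
      refine (hn.div (hn.const_add 1) hne).congr_deriv ?_
      field_simp
      ring
    · intro n w hw
      rw [norm_div, norm_neg, norm_pow, norm_pow, Complex.norm_real, Real.norm_of_nonneg h0.le]
      have := (qA_aux h0 h1 hw n).1
      rw [div_eq_mul_inv]
      gcongr
      rw [show (2/(1-Q))^2 = (((1-Q)/2)^2)⁻¹ by rw [← inv_pow, inv_div]]
      have : 0 < (1-Q)/2 := by linarith
      gcongr
    · have : 0 < 1 / Q := by positivity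
      simp only [Metric.mem_ball, dist_self]; linarith
    · simp
  have e : (-∑' n : ℕ, (Q:ℂ)^(n+1) / (1 - (Q:ℂ)^(n+1))^2) = (∑' n : ℕ, -((Q:ℂ)^(n+1)) / (1 + -((Q:ℂ)^(n+1) * 1))^2) := by
    rw [← tsum_neg]; congr 1; ext n; rw [mul_one, neg_div, sub_eq_add_neg]
  rw [e]
  refine key.congr_of_eventuallyEq ?_
  filter_upwards [Metric.isOpen_ball.mem_nhds hm] with w hw
  exact qA_logDeriv h0 h1 hw

lemma diff_deriv {f : ℂ → ℂ} (h : Differentiable ℂ f) : Differentiable ℂ (deriv f) := by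
  have := h.contDiff (n := 2)
  exact (this.differentiable_deriv_two)

/-- Third Taylor coefficient of theta at zero. -/
lemma thS3_zero {r : ℝ} (hr : 0 < r) :
    thS 3 r 0 / thS 1 r 0 = -1/4 + 6 * ∑' n : ℕ, ((Real.exp (-2*r) : ℝ):ℂ)^(n+1) / (1 - ((Real.exp (-2*r) : ℝ):ℂ)^(n+1))^2 := by
  obtain ⟨c, hc, hcP, -⟩ := thS_c_pos hr
  have hl := qA_logDeriv2 (Q_pos r) (Q_lt hr)
  have hA := qA_differentiable (Q_pos r) (Q_lt hr)
  have hA1ne := qA_one_ne_zero hr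
  set S := ∑' n : ℕ, ((Real.exp (-2*r) : ℝ):ℂ)^(n+1) / (1 - ((Real.exp (-2*r) : ℝ):ℂ)^(n+1))^2 with hS
  have hthP : ∀ z, thS 0 r z = c * (sin (z / 2) * (qA (Real.exp (-2 * r)) (cexp (I * z)) * qA (Real.exp (-2 * r)) (cexp (-(I * z))))) := hcP
  generalize qA (Real.exp (-2 * r)) = A at *
  have hA1 := diff_deriv hA
  have hA2 := diff_deriv hA1
  set A1 := deriv A with hA1d
  set A2 := deriv A1 with hA2d
  have hS' : A1 1 * A 1 + A2 1 * A 1 - A1 1 ^ 2 = - S * A 1 ^ 2 := by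
    have h2 := ((hasDerivAt_id (1:ℂ)).mul (hA1 1).hasDerivAt).div (hA 1).hasDerivAt hA1ne
    have h3 := h2.unique hl
    simp only [id, one_mul, Pi.mul_apply] at h3
    rw [div_eq_iff (pow_ne_zero 2 hA1ne)] at h3
    linear_combination h3
  have e1 : ∀ z : ℂ, HasDerivAt (fun z => cexp (I * z)) (I * cexp (I * z)) z := fun z => by
    simpa [mul_comm] using ((hasDerivAt_id z).const_mul I).cexp
  have e2 : ∀ z : ℂ, HasDerivAt (fun z => cexp (-(I * z))) (-(I * cexp (-(I * z)))) z := fun z => by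
    simpa [mul_comm] using ((hasDerivAt_id z).const_mul I).neg.cexp
  have f1 : ∀ (F : ℂ → ℂ) (hF : Differentiable ℂ F) (z : ℂ), HasDerivAt (fun z => F (cexp (I*z))) (deriv F (cexp (I*z)) * (I * cexp (I * z))) z :=
    fun F hF z => (hF _).hasDerivAt.comp z (e1 z)
  have f2 : ∀ (F : ℂ → ℂ) (hF : Differentiable ℂ F) (z : ℂ), HasDerivAt (fun z => F (cexp (-(I*z)))) (deriv F (cexp (-(I*z))) * (-(I * cexp (-(I * z))))) z :=
    fun F hF z => (hF _).hasDerivAt.comp z (e2 z)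
  set B : ℂ → ℂ := fun z => A (cexp (I*z)) * A (cexp (-(I*z))) with hB
  have hBd : ∀ z, HasDerivAt B (A1 (cexp (I*z)) * (I * cexp (I * z)) * A (cexp (-(I*z))) + A (cexp (I*z)) * (A1 (cexp (-(I*z))) * (-(I * cexp (-(I * z)))))) z :=
    fun z => (f1 A hA z).mul (f2 A hA z)
  set B1 : ℂ → ℂ := fun z => (A1 (cexp (I*z)) * (I * cexp (I * z)) * A (cexp (-(I*z))) + A (cexp (I*z)) * (A1 (cexp (-(I*z))) * (-(I * cexp (-(I * z)))))) with hB1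
  have hB1diff : Differentiable ℂ B1 := by rw [hB1]; fun_prop
  have hB1d : HasDerivAt B1 (2 * S * A 1 ^ 2) 0 := by
    have h := (((f1 A1 hA1 0).mul ((e1 0).const_mul I)).mul (f2 A hA 0)).add
      ((f1 A hA 0).mul ((f2 A1 hA1 0).mul ((e2 0).const_mul I).neg))
    refine h.congr_deriv ?_
    simp only [Pi.mul_apply, Pi.neg_apply, mul_zero, neg_zero, Complex.exp_zero, ← hA1d, ← hA2d]
    linear_combination (-2) * hS' + (2 * (A2 1 * A 1 + A1 1 * A 1 - A1 1 ^ 2)) * I_sq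
  have hB10 : B1 0 = 0 := by simp [hB1]; ring
  have hB0 : B 0 = A 1 ^ 2 := by simp [hB]; ring
  have hs : ∀ z : ℂ, HasDerivAt (fun z : ℂ => sin (z/2)) (cos (z/2) * (1/2)) z := fun z =>
    ((hasDerivAt_id z).div_const 2).csin
  have hcs : ∀ z : ℂ, HasDerivAt (fun z : ℂ => cos (z/2)) (-sin (z/2) * (1/2)) z := fun z =>
    ((hasDerivAt_id z).div_const 2).ccos
  set B2 := deriv B1 with hB2
  have hB2d := diff_deriv hB1diff
  have hB20 : B2 0 = 2 * S * A 1 ^ 2 := hB1d.deriv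
  have t0 : thS 0 r = fun z => c * (sin (z/2) * B z) := funext hthP
  have t1 : thS 1 r = fun z => c * (cos (z/2) * (1/2) * B z + sin (z/2) * B1 z) := by
    funext z
    have h := thS_hasDerivAt_z 0 hr z
    rw [t0] at h
    exact h.unique (((hs z).mul (hBd z)).const_mul (c:ℂ))
  have t2 : thS 2 r = fun z => c * ((-sin (z/2) * (1/2) * (1/2)) * B z + cos (z/2) * (1/2) * B1 z + (cos (z/2) * (1/2) * B1 z + sin (z/2) * B2 z)) := by
    funext z
    have h := thS_hasDerivAt_z 1 hr z
    rw [t1] at h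
    exact h.unique (((((hcs z).mul_const (1/2)).mul (hBd z)).add ((hs z).mul (hB1diff z).hasDerivAt)).const_mul (c:ℂ))
  have t3 : thS 3 r 0 = c * (-1/8 * B 0 + 3/2 * B2 0) := by
    have h := thS_hasDerivAt_z 2 hr 0
    rw [t2] at h
    have g := ((((((hs 0).neg.mul_const (1/2)).mul_const (1/2)).mul (hBd 0)).add (((hcs 0).mul_const (1/2)).mul (hB1diff 0).hasDerivAt)).add
      ((((hcs 0).mul_const (1/2)).mul (hB1diff 0).hasDerivAt).add ((hs 0).mul (hB2d 0).hasDerivAt))).const_mul (c:ℂ)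
    have := h.unique g
    rw [this]
    simp only [Pi.neg_apply, zero_div, Complex.sin_zero, Complex.cos_zero, ← hB2]
    ring
  have t1' : thS 1 r 0 = c * (1/2 * B 0) := by
    rw [t1]; simp
  rw [t3, t1', hB20, hB0]
  have : (c:ℂ) ≠ 0 := by exact_mod_cast hc.ne'
  field_simp
  ring

open Complex

lemma tsum_telescope {f : ℤ → ℂ} (hs : Summable (fun m : ℤ => f m - f (m+1)))
    (h1 : Filter.Tendsto (fun n : ℕ => f n) Filter.atTop (nhds 0))
    (h2 : Filter.Tendsto (fun n : ℕ => f (-n)) Filter.atTop (nhds 0)) :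
    ∑' m : ℤ, (f m - f (m+1)) = 0 := by
  have h := hs.hasSum.comp (Finset.tendsto_Ico_neg (R := ℤ))
  have h3 : Filter.Tendsto (fun n : ℕ => f (-n) - f n) Filter.atTop (nhds (0 - 0)) := h2.sub h1
  rw [sub_zero] at h3
  refine tendsto_nhds_unique h (h3.congr fun b => ?_)
  exact (Finset.sum_Ico_int_sub b f).symm

noncomputable def latT (r : ℝ) (p : ℤ × ℤ) : ℂ :=
  1 / (Real.pi - latPt r p) + 1 / latPt r p + Real.pi / latPt r p ^ 2

noncomputable def tauH (r : ℝ) (hr : 0 < r) : UpperHalfPlane :=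
  ⟨I * (r / Real.pi : ℝ), by
    simp only [mul_im, I_re, zero_mul, I_im, one_mul, ofReal_im, ofReal_re, zero_add]; positivity⟩

lemma tauH_coe (r : ℝ) (hr : 0 < r) : ((tauH r hr : UpperHalfPlane) : ℂ) = I * (r / Real.pi : ℝ) := rfl

lemma latPt_eq {r : ℝ} (hr : 0 < r) (p : ℤ × ℤ) :
    latPt r p = 2 * Real.pi * (p.2 * (tauH r hr : ℂ) + p.1) := by
  have : (Real.pi:ℂ) ≠ 0 := by exact_mod_cast Real.pi_ne_zero
  rw [tauH_coe, latPt]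
  push_cast
  field_simp
  ring

lemma latPt_re (r : ℝ) (p : ℤ × ℤ) : (latPt r p).re = 2 * Real.pi * p.1 := by
  simp [latPt]
lemma latPt_im (r : ℝ) (p : ℤ × ℤ) : (latPt r p).im = 2 * r * p.2 := by
  simp [latPt]

lemma latPt_eq_zero {r : ℝ} (hr : 0 < r) {p : ℤ × ℤ} (h : latPt r p = 0) : p = 0 := by
  have h1 := latPt_re r p
  have h2 := latPt_im r p
  rw [h] at h1 h2
  simp [Real.pi_ne_zero, hr.ne'] at h1 h2
  exact Prod.ext h1 h2

lemma norm_pi_sub_latPt (r : ℝ) (p : ℤ × ℤ) : ‖latPt r p‖ ≤ 2 * ‖(Real.pi : ℂ) - latPt r p‖ := by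
  have h : ‖latPt r p‖ ^ 2 ≤ (2 * ‖(Real.pi : ℂ) - latPt r p‖) ^ 2 := by
    rw [mul_pow, Complex.sq_norm, Complex.sq_norm, Complex.normSq_apply, Complex.normSq_apply]
    simp only [sub_re, sub_im, ofReal_re, ofReal_im, latPt_re, latPt_im]
    have hm : (p.1:ℝ)^2 ≤ (2 * p.1 - 1)^2 := by
      have : p.1 ≤ 0 ∨ 1 ≤ p.1 := by omega
      rcases this with h | h
      · have : (p.1:ℝ) ≤ 0 := by exact_mod_cast h
        nlinarith
      · have : (1:ℝ) ≤ p.1 := by exact_mod_cast h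
        nlinarith
    have := mul_le_mul_of_nonneg_left hm (sq_nonneg (2 * Real.pi))
    nlinarith [sq_nonneg (2 * r * p.2), sq_nonneg (Real.pi * p.1)]
  exact le_of_sq_le_sq h (by positivity) |> fun h => h

lemma pi_sub_latPt_ne {r : ℝ} (p : ℤ × ℤ) : (Real.pi : ℂ) - latPt r p ≠ 0 := by
  intro h
  have h1 := norm_pi_sub_latPt r p
  rw [h, norm_zero, mul_zero] at h1
  have h2 : latPt r p = 0 := norm_le_zero_iff.1 h1
  rw [h2, sub_zero] at h
  exact Real.pi_ne_zero (by exact_mod_cast h)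

lemma latT_summable {r : ℝ} (hr : 0 < r) : Summable (latT r) := by
  have h3 := EisensteinSeries.summable_norm_eisSummand (k := 3) le_rfl (tauH r hr)
  have h4 : Summable (fun p : ℤ × ℤ => ‖latPt r p‖⁻¹ ^ 3) := by
    have h5 := (((finTwoArrowEquiv ℤ).trans (Equiv.prodComm ℤ ℤ)).symm.summable_iff).2 h3
    refine (h5.mul_left (((2 * Real.pi)⁻¹)^3)).congr fun p => ?_
    simp only [EisensteinSeries.eisSummand, Function.comp_apply]
    rw [latPt_eq hr]
    simp [abs_of_pos Real.pi_pos]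
    norm_cast
    ring
  have h6 : Summable (fun p : ℤ × ℤ => if p = 0 then (0:ℂ) else latT r p) := by
    refine Summable.of_norm_bounded (h4.mul_left (2 * Real.pi ^ 2)) fun p => ?_
    split_ifs with hp
    · simp; positivity
    have hne : latPt r p ≠ 0 := fun h => hp (latPt_eq_zero hr h)
    have hne2 := pi_sub_latPt_ne (r := r) p
    have : latT r p = Real.pi ^ 2 / (latPt r p ^ 2 * (Real.pi - latPt r p)) := by
      rw [latT]; field_simp; ring
    rw [this, norm_div, norm_mul, norm_pow, norm_pow, Complex.norm_real, Real.norm_of_nonneg Real.pi_pos.le]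
    have h7 := norm_pi_sub_latPt r p
    have h8 : 0 < ‖latPt r p‖ := norm_pos_iff.2 hne
    have h9 : 0 < ‖(Real.pi:ℂ) - latPt r p‖ := norm_pos_iff.2 hne2
    rw [div_le_iff₀ (by positivity)]
    rw [show 2 * Real.pi ^ 2 * ‖latPt r p‖⁻¹ ^ 3 * (‖latPt r p‖ ^ 2 * ‖(Real.pi:ℂ) - latPt r p‖) =
      Real.pi ^ 2 * ((2 * ‖(Real.pi:ℂ) - latPt r p‖) / ‖latPt r p‖) by field_simp]
    have : 1 ≤ (2 * ‖(Real.pi:ℂ) - latPt r p‖) / ‖latPt r p‖ := by rwa [le_div_iff₀ h8, one_mul]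
    nlinarith [sq_nonneg Real.pi]
  have h7 := h6.add (summable_of_hasFiniteSupport (f := fun p : ℤ × ℤ => if p = 0 then latT r p else 0)
    ((Set.finite_singleton (0 : ℤ × ℤ)).subset (by intro p; simp; intro h _; exact h)))
  refine h7.congr fun p => ?_
  split_ifs <;> simp

lemma wzeta_eq_tsum {r : ℝ} (hr : 0 < r) : wzeta r Real.pi = ∑' p, latT r p := by
  rw [(latT_summable hr).tsum_eq_add_tsum_ite 0, wzeta]
  congr 1
  · simp [latT, latPt]

lemma latPt_neg (r : ℝ) (p : ℤ × ℤ) : latPt r (-p) = - latPt r p := by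
  simp [latPt]; ring

/-- Row sums. -/
lemma latT_row {r : ℝ} (hr : 0 < r) (n : ℤ) :
    ∑' m : ℤ, (latT r (m, n) + latT r (-(m, n))) / 2 = (4 * Real.pi : ℂ)⁻¹ * EisensteinSeries.e2Summand n (tauH r hr) := by
  have hpi : (Real.pi:ℂ) ≠ 0 := by exact_mod_cast Real.pi_ne_zero
  have s1 : Summable (fun m : ℤ => latT r (m, n)) :=
    ((latT_summable hr).comp_injective (i := fun m : ℤ => (m, n)) (fun a b h => (Prod.mk.inj h).1))
  have s2 : Summable (fun m : ℤ => latT r (-(m, n))) :=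
    ((latT_summable hr).comp_injective (i := fun m : ℤ => -(m, n)) (fun a b h => (Prod.mk.inj (neg_injective h)).1))
  have s3 := (EisensteinSeries.e2Summand_summable n (tauH r hr)).mul_left ((4 * Real.pi : ℂ)⁻¹)
  have e3 : ∀ m : ℤ, (4 * Real.pi : ℂ)⁻¹ * EisensteinSeries.eisSummand 2 ![n, m] (tauH r hr) = Real.pi / latPt r (m, n) ^ 2 := by
    intro m
    rw [latPt_eq hr]
    simp only [EisensteinSeries.eisSummand]
    simp
    norm_cast
    push_cast
    field_simp
    norm_num
  set f : ℤ → ℂ := fun m => 1 / (latPt r (m,n) - Real.pi) with hf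
  have e4 : ∀ m : ℤ, (latT r (m, n) + latT r (-(m, n))) / 2 - (4 * Real.pi : ℂ)⁻¹ * EisensteinSeries.eisSummand 2 ![n, m] (tauH r hr)
      = (-1/2) * (f m - f (m+1)) := by
    intro m
    rw [e3, latT, latT, latPt_neg, hf]
    have : latPt r (m+1, n) = latPt r (m,n) + 2 * Real.pi := by simp [latPt]; ring
    simp only [this]
    rw [show latPt r (m,n) + 2 * Real.pi - Real.pi = Real.pi - -latPt r (m,n) by ring,
      ← neg_sub (Real.pi:ℂ) (latPt r (m,n))]
    simp only [one_div, inv_neg, neg_sq]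
    ring
  have s5 : Summable (fun m : ℤ => f m - f (m+1)) := by
    have := (((s1.add s2).div_const 2).sub s3).mul_left (-2)
    refine this.congr fun m => ?_
    rw [e4]; ring
  have lim : ∀ g : ℕ → ℤ, Filter.Tendsto (fun k => |((g k : ℤ) : ℝ)|) Filter.atTop Filter.atTop →
      Filter.Tendsto (fun k : ℕ => f (g k)) Filter.atTop (nhds 0) := by
    intro g hg
    rw [tendsto_zero_iff_norm_tendsto_zero]
    simp only [hf, norm_div, norm_one]
    simp_rw [one_div]
    apply Filter.Tendsto.inv_tendsto_atTop
    refine Filter.tendsto_atTop_mono (f := fun k => |((g k : ℤ):ℝ)| * (2 * Real.pi) - Real.pi) (fun k => ?_) ?_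
    · have h1 := Complex.abs_re_le_norm (latPt r (g k, n) - Real.pi)
      rw [sub_re, latPt_re, ofReal_re] at h1
      have h2 := abs_sub_abs_le_abs_sub (2 * Real.pi * (g k:ℝ)) Real.pi
      rw [abs_mul, abs_of_pos Real.pi_pos, abs_of_pos (by positivity : 0 < 2 * Real.pi)] at h2
      simp only at h1
      linarith
    · exact Filter.tendsto_atTop_add_const_right _ _ (hg.atTop_mul_const (by positivity))
  have t5 := tsum_telescope s5 (lim (fun k => k) (by simpa using tendsto_natCast_atTop_atTop))
    (lim (fun k => -k) (by simpa using tendsto_natCast_atTop_atTop))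
  have : ∑' m : ℤ, ((latT r (m, n) + latT r (-(m, n))) / 2 - (4 * Real.pi : ℂ)⁻¹ * EisensteinSeries.eisSummand 2 ![n, m] (tauH r hr)) = 0 := by
    simp_rw [e4]
    rw [tsum_mul_left, t5, mul_zero]
  rw [((s1.add s2).div_const 2).tsum_sub s3, sub_eq_zero] at this
  rw [this, tsum_mul_left]
  rfl

lemma wzeta_pi {r : ℝ} (hr : 0 < r) :
    wzeta r Real.pi / Real.pi = 1/12 - 2 * ∑' n : ℕ, ((Real.exp (-2*r) : ℝ):ℂ)^(n+1) / (1 - ((Real.exp (-2*r) : ℝ):ℂ)^(n+1))^2 := by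
  have hpi : (Real.pi:ℂ) ≠ 0 := by exact_mod_cast Real.pi_ne_zero
  have s := latT_summable hr
  have s' : Summable (fun p => latT r (-p)) := (Equiv.neg (ℤ × ℤ)).summable_iff.2 s
  have e1 : wzeta r Real.pi = ∑' p, (latT r p + latT r (-p)) / 2 := by
    rw [wzeta_eq_tsum hr, tsum_div_const, s.tsum_add s',
      show ∑' p, latT r (-p) = ∑' p, latT r p from (Equiv.neg (ℤ × ℤ)).tsum_eq (latT r)]
    ring
  have s2 : Summable (fun p => (latT r p + latT r (-p)) / 2) := (s.add s').div_const 2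
  have s3 : Summable (fun p : ℤ × ℤ => (latT r p.swap + latT r (-p.swap)) / 2) :=
    (Equiv.prodComm ℤ ℤ).summable_iff.2 s2
  have h1 : HasSum (fun p : ℤ × ℤ => (latT r p.swap + latT r (-p.swap)) / 2) (wzeta r Real.pi) := by
    have := s3.hasSum
    rwa [show ∑' p : ℤ × ℤ, (latT r p.swap + latT r (-p.swap)) / 2 = wzeta r Real.pi by
      rw [e1]; exact (Equiv.prodComm ℤ ℤ).tsum_eq (fun p => (latT r p + latT r (-p)) / 2)] at this
  have h2 : HasSum (fun n : ℤ => (4 * Real.pi : ℂ)⁻¹ * EisensteinSeries.e2Summand n (tauH r hr)) (wzeta r Real.pi) := by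
    refine HasSum.prod_fiberwise h1 fun n => ?_
    rw [← latT_row hr n]
    exact (s3.prod_factor n).hasSum
  have h3 := (EisensteinSeries.hasSum_e2Summand_symmetricIcc (tauH r hr)).mul_left ((4 * Real.pi : ℂ)⁻¹)
  have h4 : HasSum (fun n : ℤ => (4 * Real.pi : ℂ)⁻¹ * EisensteinSeries.e2Summand n (tauH r hr)) (wzeta r Real.pi) (SummationFilter.symmetricIcc ℤ) :=
    h2.mono_left SummationFilter.LeAtTop.le_atTop
  have h5 := h4.unique h3
  have hq : cexp (2 * Real.pi * I * (tauH r hr : ℂ)) = ((Real.exp (-2*r) : ℝ):ℂ) := by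
    rw [tauH_coe]; push_cast; congr 1
    field_simp
    linear_combination (r : ℂ) * I_sq
  rw [hq, riemannZeta_two] at h5
  set Q : ℂ := ((Real.exp (-2*r) : ℝ):ℂ) with hQ
  have hQn : ‖Q‖ < 1 := by
    rw [hQ, Complex.norm_real, Real.norm_of_nonneg (Real.exp_pos _).le]; exact Q_lt hr
  have h6 := tsum_prod_pow_eq_tsum_sigma 1 hQn
  have h7 : ∀ d : ℕ+, ∑' c : ℕ+, ((c:ℕ):ℂ)^1 * Q^((d:ℕ) * (c:ℕ)) = Q^(d:ℕ) / (1 - Q^(d:ℕ))^2 := by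
    intro d
    have hd : ‖Q^(d:ℕ)‖ < 1 := by
      rw [norm_pow]; exact pow_lt_one₀ (norm_nonneg _) hQn d.ne_zero
    rw [← tsum_coe_mul_geometric_of_norm_lt_one hd, ← tsum_zero_pnat_eq_tsum_nat]
    · simp [pow_mul]
    · exact (hasSum_coe_mul_geometric_of_norm_lt_one hd).summable
  have h8 : ∑' e : ℕ+, (ArithmeticFunction.sigma 1 e : ℂ) * Q ^ (e:ℕ) = ∑' n : ℕ, Q^(n+1) / (1 - Q^(n+1))^2 := by
    rw [← h6, ← tsum_pnat_eq_tsum_succ (f := fun n : ℕ => Q^n / (1 - Q^n)^2)]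
    exact tsum_congr h7
  rw [h8] at h5
  rw [h5]
  field_simp
  ring

/-- The link between theta constants and the Weierstrass zeta function. -/
lemma thS3_wzeta {r : ℝ} (hr : 0 < r) : thS 3 r 0 / thS 1 r 0 = -3 * (wzeta r Real.pi / Real.pi) := by
  rw [thS3_zero hr, wzeta_pi hr]; ring

open Complex

/-- Real theta derivatives. -/
noncomputable def rT (k : ℕ) (s y : ℝ) : ℝ := (thS k s (y:ℂ)).re

lemma rT_coe (k : ℕ) (s y : ℝ) : thS k s (y:ℂ) = ((rT k s y : ℝ) : ℂ) := (thS_real k s y).symm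

lemma rT_hasDerivAt_y (k : ℕ) {s : ℝ} (hs : 0 < s) (y : ℝ) :
    HasDerivAt (rT k s) (rT (k+1) s y) y :=
  HasDerivAt.real_of_complex (thS_hasDerivAt_z k hs (y:ℂ))

lemma rT_hasDerivAt_s (k : ℕ) {s : ℝ} (hs : 0 < s) (y : ℝ) :
    HasDerivAt (fun s => rT k s y) (rT (k+2) s y) s := by
  have h := thS_hasDerivAt_s k hs (y:ℂ)
  exact (reCLM.hasFDerivAt.comp_hasDerivAt s h)

lemma rT_continuousAt (k : ℕ) {s : ℝ} (hs : 0 < s) (y : ℝ) :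
    ContinuousAt (fun p : ℝ × ℝ => rT k p.1 p.2) (s, y) := by
  have h := thS_continuousAt k hs (y:ℂ)
  have g : ContinuousAt (fun p : ℝ × ℝ => ((p.1, (p.2:ℂ)) : ℝ × ℂ)) (s, y) := by fun_prop
  have h2 : ContinuousAt ((fun p : ℝ × ℂ => thS k p.1 p.2) ∘ (fun p : ℝ × ℝ => ((p.1, (p.2:ℂ)) : ℝ × ℂ))) (s, y) :=
    ContinuousAt.comp h g
  exact Complex.continuous_re.continuousAt.comp h2

lemma rT_continuous (k : ℕ) {s : ℝ} (hs : 0 < s) : Continuous (rT k s) :=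
  continuous_iff_continuousAt.2 fun y => (rT_hasDerivAt_y k hs y).continuousAt

lemma rT0_pos {s : ℝ} (hs : 0 < s) {y : ℝ} (hy : y ∈ Set.Ioo 0 (2 * Real.pi)) : 0 < rT 0 s y := thS0_pos hs hy
lemma rT1_pos {s : ℝ} (hs : 0 < s) : 0 < rT 1 s 0 := by simpa [rT] using thS1_zero_pos hs
lemma rT0_zero (s : ℝ) : rT 0 s 0 = 0 := by have := thS0_zero 0 s; simp at this; simp [rT, this]
lemma rT2_zero (s : ℝ) : rT 2 s 0 = 0 := by have := thS0_zero 1 s; simp at this; simp [rT, this]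

/-- The functional identity in real form. -/
lemma rT_identity {r : ℝ} (hr : 0 < r) {x t : ℝ} (ht : t ∈ Set.Ioo 0 (2 * Real.pi)) (hu : x - t ∈ Set.Ioo 0 (2 * Real.pi))
    (hx : x ∈ Set.Ioo 0 (2 * Real.pi)) :
    rT 2 r x / rT 0 r x + rT 2 r (x-t) / rT 0 r (x-t) + rT 2 r t / rT 0 r t
      + 2 * (rT 1 r (x-t) / rT 0 r (x-t)) * (rT 1 r t / rT 0 r t)
      - 2 * (rT 1 r x / rT 0 r x) * (rT 1 r (x-t) / rT 0 r (x-t))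
      - 2 * (rT 1 r x / rT 0 r x) * (rT 1 r t / rT 0 r t) = rT 3 r 0 / rT 1 r 0 := by
  have h := thE_eq_zero hr ht ((x - t : ℝ) : ℂ)
  have h1 := rT0_pos hr ht
  have h2 := rT0_pos hr hu
  have h3 := rT0_pos hr hx
  have h4 := rT1_pos hr
  unfold thE at h
  have e : (((x - t : ℝ) : ℂ) + t) = ((x:ℝ):ℂ) := by push_cast; ring
  have e0 : (0:ℂ) = ((0:ℝ):ℂ) := by simp
  rw [e, e0] at h
  simp only [rT_coe] at h
  have h' : rT 2 r x * rT 0 r (x-t) * rT 0 r t + rT 0 r x * rT 2 r (x-t) * rT 0 r t + rT 0 r x * rT 0 r (x-t) * rT 2 r t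
    + 2 * rT 0 r x * rT 1 r (x-t) * rT 1 r t - 2 * rT 1 r x * rT 1 r (x-t) * rT 0 r t - 2 * rT 1 r x * rT 0 r (x-t) * rT 1 r t
    - rT 3 r 0 / rT 1 r 0 * rT 0 r x * rT 0 r (x-t) * rT 0 r t = 0 := by exact_mod_cast h
  have h5 : rT 3 r 0 / rT 1 r 0 = (rT 2 r x * rT 0 r (x-t) * rT 0 r t + rT 0 r x * rT 2 r (x-t) * rT 0 r t + rT 0 r x * rT 0 r (x-t) * rT 2 r t
    + 2 * rT 0 r x * rT 1 r (x-t) * rT 1 r t - 2 * rT 1 r x * rT 1 r (x-t) * rT 0 r t - 2 * rT 1 r x * rT 0 r (x-t) * rT 1 r t) / (rT 0 r x * rT 0 r (x-t) * rT 0 r t) := by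
    rw [eq_div_iff (by positivity)]; linear_combination -h'
  rw [h5]
  field_simp

lemma rT3_wzeta {r : ℝ} (hr : 0 < r) : rT 3 r 0 / rT 1 r 0 = -3 * ((wzeta r Real.pi).re / Real.pi) := by
  have h := thS3_wzeta hr
  have e0 : (0:ℂ) = ((0:ℝ):ℂ) := by simp
  rw [e0, rT_coe, rT_coe, ← Complex.ofReal_div] at h
  have := congrArg Complex.re h
  rw [ofReal_re] at this
  rw [this, show (-3 : ℂ) * (wzeta r Real.pi / Real.pi) = (((-3 / Real.pi : ℝ)) : ℂ) * wzeta r Real.pi by push_cast; ring, re_ofReal_mul]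
  ring

lemma rT_bounds {r : ℝ} (hr : 0 < r) {x : ℝ} (hx : x ∈ Set.Ioo 0 (2 * Real.pi)) :
    ∃ δ > 0, δ < r ∧ ∃ c > 0, ∃ C ≥ 0, ∀ s, |s - r| ≤ δ → ∀ t, 0 < t → t ≤ x →
      c * t ≤ rT 0 s t ∧ |rT 2 s t| ≤ C * t := by
  have hm := rT1_pos hr
  have hc := rT_continuousAt 1 hr 0
  have hev : ∀ᶠ p : ℝ × ℝ in nhds (r, 0), rT 1 r 0 / 2 < rT 1 p.1 p.2 :=
    hc.eventually (lt_mem_nhds (by simp only; linarith))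
  obtain ⟨ε, hε, hball⟩ := Metric.eventually_nhds_iff.1 hev
  set δ := min (ε/2) (r/2) with hδ
  have hδ0 : 0 < δ := by positivity
  have hδr : δ < r := lt_of_le_of_lt (min_le_right _ _) (by linarith)
  have hδε : δ < ε := lt_of_le_of_lt (min_le_left _ _) (by linarith)
  have hspos : ∀ s, |s - r| ≤ δ → 0 < s := fun s hs => by have := (abs_le.1 hs).1; linarith
  have hK1 : IsCompact (Set.Icc (r-δ) (r+δ) ×ˢ Set.Icc δ x) := isCompact_Icc.prod isCompact_Icc
  have hK2 : IsCompact (Set.Icc (r-δ) (r+δ) ×ˢ Set.Icc 0 x) := isCompact_Icc.prod isCompact_Icc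
  have hcont : ∀ k, ∀ K ⊆ Set.Icc (r-δ) (r+δ) ×ˢ (Set.univ : Set ℝ), ContinuousOn (fun p : ℝ × ℝ => rT k p.1 p.2) K := by
    intro k K hK p hp
    have h1 := (hK hp).1
    exact (rT_continuousAt k (by linarith [h1.1]) p.2).continuousWithinAt
  have hlow : ∃ c0 > 0, ∀ p ∈ Set.Icc (r-δ) (r+δ) ×ˢ Set.Icc δ x, c0 ≤ rT 0 p.1 p.2 := by
    refine hK1.exists_forall_le' (hcont 0 _ (Set.prod_mono_right (Set.subset_univ _))) (a := 0) ?_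
    rintro p ⟨h1, h2⟩
    exact rT0_pos (by linarith [h1.1]) ⟨by linarith [h2.1], by linarith [h2.2, hx.2]⟩
  obtain ⟨c0, hc0, hlow⟩ := hlow
  obtain ⟨C, hC⟩ := hK2.exists_bound_of_continuousOn (hcont 3 _ (Set.prod_mono_right (Set.subset_univ _)))
  refine ⟨δ, hδ0, hδr, min (rT 1 r 0 / 2) (c0 / x), lt_min (by positivity) (div_pos hc0 hx.1), max C 0, le_max_right _ _, ?_⟩
  intro s hs t ht0 htx
  have hs0 := hspos s hs
  have hsI : s ∈ Set.Icc (r-δ) (r+δ) := ⟨by linarith [(abs_le.1 hs).1], by linarith [(abs_le.1 hs).2]⟩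
  constructor
  · by_cases htd : t < δ
    · have := Convex.mul_sub_le_image_sub_of_le_deriv (convex_Icc 0 t) (f := rT 0 s)
        (rT_continuous 0 hs0).continuousOn
        (fun y _ => (rT_hasDerivAt_y 0 hs0 y).differentiableAt.differentiableWithinAt) (C := rT 1 r 0 / 2)
        (by
          intro y hy
          rw [interior_Icc] at hy
          rw [(rT_hasDerivAt_y 0 hs0 y).deriv]
          refine (hball (y := (s, y)) ?_).le
          rw [Prod.dist_eq, max_lt_iff, Real.dist_eq, Real.dist_eq, sub_zero, abs_of_pos hy.1]
          exact ⟨lt_of_le_of_lt hs hδε, by linarith [hy.2]⟩) 0 ⟨le_rfl, ht0.le⟩ t ⟨ht0.le, le_rfl⟩ ht0.le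
      rw [rT0_zero, sub_zero, sub_zero] at this
      refine le_trans ?_ this
      gcongr
      exact min_le_left _ _
    · have h := hlow (s, t) ⟨hsI, not_lt.1 htd, htx⟩
      calc _ ≤ c0 / x * t := by gcongr; exact min_le_right _ _
        _ ≤ c0 / x * x := by gcongr; exact (div_pos hc0 hx.1).le
        _ = c0 := by have := hx.1.ne'; field_simp
        _ ≤ _ := h
  · have := Convex.norm_image_sub_le_of_norm_hasDerivWithin_le (s := Set.Icc 0 t) (f := rT 2 s) (f' := rT 3 s) (C := max C 0)
      (x := 0) (y := t)
      (fun y _ => (rT_hasDerivAt_y 2 hs0 y).hasDerivWithinAt)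
      (fun y hy => (hC (s, y) ⟨hsI, hy.1, hy.2.trans htx⟩).trans (le_max_left _ _)) (convex_Icc 0 t) ⟨le_rfl, ht0.le⟩ ⟨ht0.le, le_rfl⟩
    rw [rT2_zero, sub_zero, sub_zero, Real.norm_eq_abs, Real.norm_eq_abs, abs_of_pos ht0] at this
    exact this

open Complex MeasureTheory

noncomputable def fT (a s t : ℝ) : ℝ := (rT 0 s t) ^ (-a)
noncomputable def hT (s t : ℝ) : ℝ := rT 1 s t / rT 0 s t
noncomputable def vT (s t : ℝ) : ℝ := rT 2 s t / rT 0 s t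

lemma hT_deriv {s t : ℝ} (hs : 0 < s) (ht : t ∈ Set.Ioo 0 (2 * Real.pi)) :
    HasDerivAt (hT s) (vT s t - hT s t ^ 2) t := by
  have h0 := rT0_pos hs ht
  refine ((rT_hasDerivAt_y 1 hs t).div (rT_hasDerivAt_y 0 hs t) h0.ne').congr_deriv ?_
  simp only [hT, vT, Nat.reduceAdd]
  field_simp

lemma pow_deriv_y {s t : ℝ} (b : ℝ) (hs : 0 < s) (ht : t ∈ Set.Ioo 0 (2 * Real.pi)) :
    HasDerivAt (fun t => rT 0 s t ^ b) (b * hT s t * rT 0 s t ^ b) t := by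
  have h0 := rT0_pos hs ht
  refine ((rT_hasDerivAt_y 0 hs t).rpow_const (p := b) (Or.inl h0.ne')).congr_deriv ?_
  rw [Real.rpow_sub_one h0.ne']
  simp only [hT, Nat.reduceAdd]
  ring

lemma pow_deriv_s {s t : ℝ} (b : ℝ) (hs : 0 < s) (ht : t ∈ Set.Ioo 0 (2 * Real.pi)) :
    HasDerivAt (fun s => rT 0 s t ^ b) (b * vT s t * rT 0 s t ^ b) s := by
  have h0 := rT0_pos hs ht
  refine ((rT_hasDerivAt_s 0 hs t).rpow_const (p := b) (Or.inl h0.ne')).congr_deriv ?_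
  rw [Real.rpow_sub_one h0.ne']
  simp only [vT, Nat.reduceAdd]
  ring

lemma fT_deriv {a s t : ℝ} (hs : 0 < s) (ht : t ∈ Set.Ioo 0 (2 * Real.pi)) :
    HasDerivAt (fT a s) (-a * hT s t * fT a s t) t := pow_deriv_y (-a) hs ht

lemma fT_deriv_s {a s t : ℝ} (hs : 0 < s) (ht : t ∈ Set.Ioo 0 (2 * Real.pi)) :
    HasDerivAt (fun s => fT a s t) (-a * vT s t * fT a s t) s := pow_deriv_s (-a) hs ht

lemma fT1_deriv {a s t : ℝ} (hs : 0 < s) (ht : t ∈ Set.Ioo 0 (2 * Real.pi)) :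
    HasDerivAt (fun t => -a * hT s t * fT a s t)
      ((-a * (vT s t - hT s t ^ 2) + a ^ 2 * hT s t ^ 2) * fT a s t) t := by
  refine (((hT_deriv hs ht).const_mul (-a)).mul (fT_deriv hs ht)).congr_deriv ?_
  ring

lemma fT_pos {a s t : ℝ} (hs : 0 < s) (ht : t ∈ Set.Ioo 0 (2 * Real.pi)) : 0 < fT a s t :=
  Real.rpow_pos_of_pos (rT0_pos hs ht) _

lemma hT_cont {s : ℝ} (hs : 0 < s) : ContinuousOn (hT s) (Set.Ioo 0 (2 * Real.pi)) :=
  (rT_continuous 1 hs).continuousOn.div (rT_continuous 0 hs).continuousOn fun _ ht => (rT0_pos hs ht).ne'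
lemma vT_cont {s : ℝ} (hs : 0 < s) : ContinuousOn (vT s) (Set.Ioo 0 (2 * Real.pi)) :=
  (rT_continuous 2 hs).continuousOn.div (rT_continuous 0 hs).continuousOn fun _ ht => (rT0_pos hs ht).ne'
lemma fT_cont (a : ℝ) {s : ℝ} (hs : 0 < s) : ContinuousOn (fT a s) (Set.Ioo 0 (2 * Real.pi)) :=
  fun _ ht => (fT_deriv hs ht).continuousAt.continuousWithinAt

lemma fT_bound {a : ℝ} (ha : 0 < a) {r : ℝ} (hr : 0 < r) {x : ℝ} (hx : x ∈ Set.Ioo 0 (2 * Real.pi)) :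
    ∃ δ > 0, δ < r ∧ ∃ M ≥ 0, ∃ C ≥ 0, ∀ s, |s - r| ≤ δ → ∀ t, 0 < t → t ≤ x →
      fT a s t ≤ M * t ^ (-a) ∧ |vT s t| ≤ C := by
  obtain ⟨δ, hδ, hδr, c, hc, C, hC, h⟩ := rT_bounds hr hx
  refine ⟨δ, hδ, hδr, c ^ (-a), by positivity, C / c, by positivity, fun s hs t ht htx => ?_⟩
  obtain ⟨h1, h2⟩ := h s hs t ht htx
  have hct : 0 < c * t := by positivity
  constructor
  · rw [← Real.mul_rpow hc.le ht.le]
    exact Real.rpow_le_rpow_of_nonpos hct h1 (by linarith)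
  · rw [vT, abs_div, abs_of_pos (hct.trans_le h1), div_le_div_iff₀ (hct.trans_le h1) hc]
    nlinarith

lemma fT_integrable {a : ℝ} (ha : 0 < a) (ha1 : a < 1) {s : ℝ} (hs : 0 < s) {b : ℝ} (hb : b ∈ Set.Ioo 0 (2 * Real.pi)) :
    IntervalIntegrable (fT a s) volume 0 b := by
  obtain ⟨δ, hδ, -, M, hM, C, hC, h⟩ := fT_bound ha hs hb
  have hI : IntervalIntegrable (fun t : ℝ => M * t ^ (-a)) volume 0 b :=
    (intervalIntegral.intervalIntegrable_rpow' (by linarith)).const_mul M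
  refine hI.mono_fun ?_ ?_
  · rw [Set.uIoc_of_le hb.1.le]
    exact ((fT_cont a hs).mono fun t ht => ⟨ht.1, ht.2.trans_lt hb.2⟩).aestronglyMeasurable measurableSet_Ioc
  · rw [Set.uIoc_of_le hb.1.le]
    refine (ae_restrict_iff' measurableSet_Ioc).2 (Filter.Eventually.of_forall fun t ht => ?_)
    have h1 := (h s (by simpa using hδ.le) t ht.1 ht.2).1
    have h2 := fT_pos (a := a) hs (t := t) ⟨ht.1, ht.2.trans_lt hb.2⟩
    show ‖fT a s t‖ ≤ ‖M * t ^ (-a)‖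
    rw [Real.norm_of_nonneg h2.le]
    exact h1.trans (le_abs_self _)

/-- Multiplying by a function continuous on the relevant compact set. -/
lemma shift_integrable {f g : ℝ → ℝ} {x b : ℝ} (hb0 : 0 ≤ b) (hbx : b < x) (hx : x < 2 * Real.pi)
    (hf : IntervalIntegrable f volume 0 b) (hg : ContinuousOn g (Set.Ioo 0 (2 * Real.pi))) :
    IntervalIntegrable (fun t => g (x - t) * f t) volume 0 b := by
  refine hf.continuousOn_mul ?_
  rw [Set.uIcc_of_le hb0]
  refine hg.comp (by fun_prop) fun t ht => ⟨by linarith [ht.2], by linarith [ht.1]⟩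

/-- Leibniz rule with a moving endpoint. -/
lemma leibniz {f g g' : ℝ → ℝ} {x : ℝ} (hx : x ∈ Set.Ioo 0 (2 * Real.pi))
    (hf : ∀ b ∈ Set.Ioo 0 (2 * Real.pi), IntervalIntegrable f volume 0 b)
    (hfc : ContinuousOn f (Set.Ioo 0 (2 * Real.pi)))
    (hg : ∀ t ∈ Set.Ioo 0 (2 * Real.pi), HasDerivAt g (g' t) t)
    (hg' : ContinuousOn g' (Set.Ioo 0 (2 * Real.pi))) :
    HasDerivAt (fun y => ∫ t in (0:ℝ)..(y/2), g (y - t) * f t)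
      (g (x/2) * f (x/2) / 2 + ∫ t in (0:ℝ)..(x/2), g' (x - t) * f t) x := by
  have hgc : ContinuousOn g (Set.Ioo 0 (2 * Real.pi)) := fun t ht => (hg t ht).continuousAt.continuousWithinAt
  obtain ⟨hx0, hx2⟩ := hx
  set δ := min (x/4) ((2*Real.pi - x)/2) with hδ
  have hδ0 : 0 < δ := lt_min (by linarith) (by linarith)
  have hδ1 : δ ≤ x/4 := min_le_left _ _
  have hδ2 : δ ≤ (2*Real.pi - x)/2 := min_le_right _ _
  obtain ⟨C, hC⟩ := (isCompact_Icc (a := x/4) (b := x + δ)).exists_bound_of_continuousOn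
    (hg'.mono fun t ht => ⟨by linarith [ht.1], by linarith [ht.2]⟩)
  have hfx := hf (x/2) ⟨by linarith, by linarith⟩
  have hball : ∀ y ∈ Metric.ball x δ, x - δ < y ∧ y < x + δ := by
    intro y hy
    rw [Metric.mem_ball, Real.dist_eq, abs_lt] at hy
    constructor <;> linarith
  have d1 : HasDerivAt (fun y => ∫ t in (0:ℝ)..(x/2), g (y - t) * f t) (∫ t in (0:ℝ)..(x/2), g' (x - t) * f t) x := by
    refine (intervalIntegral.hasDerivAt_integral_of_dominated_loc_of_deriv_le (F := fun y t => g (y - t) * f t)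
      (F' := fun y t => g' (y - t) * f t) (bound := fun t => C * ‖f t‖) (Metric.ball_mem_nhds x hδ0) ?_ ?_ ?_ ?_ ?_ ?_).2
    · filter_upwards [Metric.ball_mem_nhds x hδ0] with y hy
      have := hball y hy
      exact (shift_integrable (x := y) (by linarith) (by linarith) (by linarith) hfx hgc).def'.aestronglyMeasurable
    · exact shift_integrable (by linarith) (by linarith) (by linarith) hfx hgc
    · exact (shift_integrable (x := x) (by linarith) (by linarith) (by linarith) hfx hg').def'.aestronglyMeasurable
    · refine Filter.Eventually.of_forall fun t ht y hy => ?_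
      rw [Set.uIoc_of_le (by linarith)] at ht
      have := hball y hy
      rw [norm_mul]
      gcongr
      exact hC _ ⟨by linarith [ht.2], by linarith [ht.1]⟩
    · exact hfx.norm.const_mul C
    · refine Filter.Eventually.of_forall fun t ht y hy => ?_
      rw [Set.uIoc_of_le (by linarith)] at ht
      have := hball y hy
      have h := hg (y - t) ⟨by linarith [ht.2], by linarith [ht.1]⟩
      exact (h.comp_sub_const y t).mul_const (f t)
  have d2 : HasDerivAt (fun y => ∫ t in (x/2)..(y/2), g (y - t) * f t) (g (x/2) * f (x/2) / 2) x := by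
    rw [hasDerivAt_iff_isLittleO, Asymptotics.isLittleO_iff]
    intro ε hε
    have hcont : ContinuousAt (fun p : ℝ × ℝ => g (p.1 - p.2) * f p.2) (x, x/2) := by
      have hm : Set.Ioo 0 (2 * Real.pi) ∈ nhds (x/2) := Ioo_mem_nhds (by linarith) (by linarith)
      have h1 : ContinuousAt g (x - x/2) := by
        rw [show x - x/2 = x/2 by ring]; exact hgc.continuousAt hm
      have h2 : ContinuousAt f (x/2) := hfc.continuousAt hm
      have h3 : ContinuousAt (fun p : ℝ × ℝ => p.1 - p.2) (x, x/2) := by fun_prop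
      have h4 : ContinuousAt (fun p : ℝ × ℝ => p.2) (x, x/2) := by fun_prop
      exact (ContinuousAt.comp (f := fun p : ℝ × ℝ => p.1 - p.2) h1 h3).mul
        (ContinuousAt.comp (f := fun p : ℝ × ℝ => p.2) h2 h4)
    obtain ⟨η, hη, hη2⟩ := Metric.continuousAt_iff.1 hcont ε hε
    filter_upwards [Metric.ball_mem_nhds x (lt_min hη hδ0)] with y hy
    rw [Metric.mem_ball, Real.dist_eq, lt_min_iff] at hy
    have hyb := hball y (by rw [Metric.mem_ball, Real.dist_eq]; exact hy.2)
    have hIntg : IntervalIntegrable (fun t => g (y - t) * f t) volume (x/2) (y/2) := by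
      apply ContinuousOn.intervalIntegrable
      have hsub : Set.uIcc (x/2) (y/2) ⊆ Set.Icc (3*x/8) (x/2 + δ/2) := by
        apply Set.uIcc_subset_Icc <;> constructor <;> linarith
      refine ContinuousOn.mul (hgc.comp (by fun_prop) fun t ht => ?_) (hfc.mono fun t ht => ?_)
      · have := hsub ht
        exact ⟨by linarith [this.2], by linarith [this.1]⟩
      · have := hsub ht
        exact ⟨by linarith [this.1], by linarith [this.2]⟩
    have e : (∫ t in (x/2)..(y/2), g (y - t) * f t) - (∫ t in (x/2)..(x/2), g (x - t) * f t) - (y - x) • (g (x/2) * f (x/2) / 2)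
        = ∫ t in (x/2)..(y/2), (g (y - t) * f t - g (x/2) * f (x/2)) := by
      rw [intervalIntegral.integral_sub hIntg (by simp), intervalIntegral.integral_same, intervalIntegral.integral_const]
      simp only [smul_eq_mul]; ring
    rw [e]
    have hb := intervalIntegral.norm_integral_le_of_norm_le_const (a := x/2) (b := y/2) (C := ε)
      (f := fun t => (g (y - t) * f t - g (x/2) * f (x/2))) (fun t ht => by
        have ht' : |t - x/2| ≤ |y/2 - x/2| := by
          have := Set.uIoc_subset_uIcc ht
          exact Set.abs_sub_left_of_mem_uIcc this
        have := hη2 (x := (y, t)) (by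
          rw [Prod.dist_eq, max_lt_iff, Real.dist_eq, Real.dist_eq]
          refine ⟨hy.1, lt_of_le_of_lt ht' ?_⟩
          rw [show y/2 - x/2 = (y-x)/2 by ring, abs_div, abs_two]
          linarith [hy.1, abs_nonneg (y-x)])
        rw [dist_eq_norm] at this
        simp only [show x - x/2 = x/2 by ring] at this
        exact this.le)
    refine hb.trans ?_
    rw [show y/2 - x/2 = (y-x)/2 by ring, abs_div, abs_two, Real.norm_eq_abs]
    have := mul_nonneg hε.le (abs_nonneg (y-x))
    linarith
  have d3 := d2.add d1
  refine d3.congr_of_eventuallyEq ?_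
  filter_upwards [Metric.ball_mem_nhds x hδ0] with y hy
  have := hball y hy
  have hbig : IntervalIntegrable (fun t => g (y - t) * f t) volume 0 (max (x/2) (y/2)) := by
    have hm : max (x/2) (y/2) < y := max_lt (by linarith) (by linarith)
    exact shift_integrable (by positivity) hm (by linarith) (hf _ ⟨by positivity, by linarith⟩) hgc
  have h0x : (0:ℝ) ≤ x/2 := by linarith
  have h0y : (0:ℝ) ≤ y/2 := by linarith
  have i1 : IntervalIntegrable (fun t => g (y - t) * f t) volume 0 (x/2) := hbig.mono_set (by
    rw [Set.uIcc_of_le h0x, Set.uIcc_of_le (h0x.trans (le_max_left _ _))]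
    exact Set.Icc_subset_Icc_right (le_max_left _ _))
  have i2 : IntervalIntegrable (fun t => g (y - t) * f t) volume 0 (y/2) := hbig.mono_set (by
    rw [Set.uIcc_of_le h0y, Set.uIcc_of_le (h0y.trans (le_max_right _ _))]
    exact Set.Icc_subset_Icc_right (le_max_right _ _))
  have := intervalIntegral.integral_add_adjacent_intervals i1 (i1.symm.trans i2)
  simp only [Pi.add_apply]
  linarith

open Complex MeasureTheory

lemma ZLZ_eq {κ s : ℝ} (hs : 0 < s) (y : ℝ) :
    ZLZ κ s y = rT 1 s 0 ^ (6/κ) * rT 0 s y ^ (2/κ) *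
      ∫ t in (0:ℝ)..y, fT (4/κ) s (y - t) * fT (4/κ) s t := by
  have e : thS 1 s 0 = ((rT 1 s 0 : ℝ) : ℂ) := by
    have := rT_coe 1 s 0
    simpa using this
  unfold ZLZ fT
  rw [deriv_Theta hs]
  simp only [Theta_eq, rT_coe, e, Complex.ofReal_re]

/-- Half-interval integral. -/
noncomputable def KT (a s y : ℝ) : ℝ := ∫ t in (0:ℝ)..(y/2), fT a s (y - t) * fT a s t

lemma half_integrable {a : ℝ} (ha : 0 < a) (ha1 : a < 1) {s : ℝ} (hs : 0 < s) {g : ℝ → ℝ}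
    (hg : ContinuousOn g (Set.Ioo 0 (2 * Real.pi))) {y : ℝ} (hy : y ∈ Set.Ioo 0 (2 * Real.pi)) :
    IntervalIntegrable (fun t => g (y - t) * fT a s t) volume 0 (y/2) :=
  shift_integrable (by linarith [hy.1]) (by linarith [hy.1]) hy.2
    (fT_integrable ha ha1 hs ⟨by linarith [hy.1], by linarith [hy.1, hy.2]⟩) hg

lemma symm_int {a : ℝ} (ha : 0 < a) (ha1 : a < 1) {s : ℝ} (hs : 0 < s) {y : ℝ} (hy : y ∈ Set.Ioo 0 (2 * Real.pi)) :
    ∫ t in (0:ℝ)..y, fT a s (y - t) * fT a s t = 2 * KT a s y := by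
  have h1 := half_integrable ha ha1 hs (fT_cont a hs) hy
  have h2 := h1.comp_sub_left y
  have e1 : (fun t => fT a s (y - (y - t)) * fT a s (y - t)) = fun t => fT a s (y - t) * fT a s t := by
    funext t; rw [sub_sub_cancel, mul_comm]
  rw [e1, sub_zero, show y - y/2 = y/2 by ring] at h2
  rw [← intervalIntegral.integral_add_adjacent_intervals h1 h2.symm]
  have h3 := intervalIntegral.integral_comp_sub_left (a := 0) (b := y/2) (fun t => fT a s (y - t) * fT a s t) y
  rw [sub_zero, show y - y/2 = y/2 by ring] at h3
  rw [← h3]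
  simp only [sub_sub_cancel]
  unfold KT
  have : ∀ t, fT a s t * fT a s (y - t) = fT a s (y - t) * fT a s t := fun t => mul_comm _ _
  simp only [this]
  ring

lemma KT_pos {a : ℝ} (ha : 0 < a) (ha1 : a < 1) {s : ℝ} (hs : 0 < s) {y : ℝ} (hy : y ∈ Set.Ioo 0 (2 * Real.pi)) :
    0 < KT a s y := by
  refine intervalIntegral.intervalIntegral_pos_of_pos_on (half_integrable ha ha1 hs (fT_cont a hs) hy) ?_ (by linarith [hy.1])
  intro t ht
  exact mul_pos (fT_pos hs ⟨by linarith [ht.2, hy.1], by linarith [ht.1, hy.2]⟩)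
    (fT_pos hs ⟨ht.1, by linarith [ht.2, hy.1, hy.2]⟩)

noncomputable def f1 (a s t : ℝ) : ℝ := -a * hT s t * fT a s t
noncomputable def f2 (a s t : ℝ) : ℝ := (-a * (vT s t - hT s t ^ 2) + a ^ 2 * hT s t ^ 2) * fT a s t

lemma f1_cont (a : ℝ) {s : ℝ} (hs : 0 < s) : ContinuousOn (f1 a s) (Set.Ioo 0 (2 * Real.pi)) :=
  (continuousOn_const.mul (hT_cont hs)).mul (fT_cont a hs)
lemma f2_cont (a : ℝ) {s : ℝ} (hs : 0 < s) : ContinuousOn (f2 a s) (Set.Ioo 0 (2 * Real.pi)) :=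
  ((continuousOn_const.mul ((vT_cont hs).sub ((hT_cont hs).pow 2))).add
    (continuousOn_const.mul ((hT_cont hs).pow 2))).mul (fT_cont a hs)

noncomputable def I1 (a s y : ℝ) : ℝ := ∫ t in (0:ℝ)..(y/2), f1 a s (y - t) * fT a s t
noncomputable def I2 (a s y : ℝ) : ℝ := ∫ t in (0:ℝ)..(y/2), f2 a s (y - t) * fT a s t
noncomputable def IS (a s y : ℝ) : ℝ :=
  ∫ t in (0:ℝ)..(y/2), -a * (vT s (y - t) + vT s t) * (fT a s (y - t) * fT a s t)

lemma KT_deriv {a : ℝ} (ha : 0 < a) (ha1 : a < 1) {s : ℝ} (hs : 0 < s) {y : ℝ} (hy : y ∈ Set.Ioo 0 (2 * Real.pi)) :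
    HasDerivAt (KT a s) (fT a s (y/2) * fT a s (y/2) / 2 + I1 a s y) y :=
  leibniz hy (fun _ hb => fT_integrable ha ha1 hs hb) (fT_cont a hs) (fun _ ht => fT_deriv hs ht) (f1_cont a hs)

lemma I1_deriv {a : ℝ} (ha : 0 < a) (ha1 : a < 1) {s : ℝ} (hs : 0 < s) {y : ℝ} (hy : y ∈ Set.Ioo 0 (2 * Real.pi)) :
    HasDerivAt (I1 a s) (f1 a s (y/2) * fT a s (y/2) / 2 + I2 a s y) y :=
  leibniz hy (fun _ hb => fT_integrable ha ha1 hs hb) (fT_cont a hs) (fun _ ht => fT1_deriv hs ht) (f2_cont a hs)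

lemma half_mem {y : ℝ} (hy : y ∈ Set.Ioo 0 (2 * Real.pi)) : y/2 ∈ Set.Ioo 0 (2 * Real.pi) :=
  ⟨by linarith [hy.1], by linarith [hy.1, hy.2]⟩

lemma fhalf_deriv {a : ℝ} {s : ℝ} (hs : 0 < s) {y : ℝ} (hy : y ∈ Set.Ioo 0 (2 * Real.pi)) :
    HasDerivAt (fun y => fT a s (y/2) * fT a s (y/2) / 2) (f1 a s (y/2) * fT a s (y/2) / 2) y := by
  have h : HasDerivAt (fun y => fT a s (y/2)) (f1 a s (y/2) * (1/2)) y :=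
    HasDerivAt.comp (h₂ := fT a s) (h := fun y : ℝ => y/2) y (fT_deriv hs (half_mem hy)) ((hasDerivAt_id y).div_const 2)
  refine ((h.mul h).div_const 2).congr_deriv ?_
  ring

lemma KT_deriv_s {a : ℝ} (ha : 0 < a) (ha1 : a < 1) {r : ℝ} (hr : 0 < r) {x : ℝ} (hx : x ∈ Set.Ioo 0 (2 * Real.pi)) :
    IntervalIntegrable (fun t => -a * (vT r (x - t) + vT r t) * (fT a r (x - t) * fT a r t)) volume 0 (x/2) ∧
    HasDerivAt (fun s => KT a s x) (IS a r x) r := by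
  obtain ⟨δ, hδ, hδr, M, hM, C, hC, h⟩ := fT_bound ha hr hx
  have hx0 := hx.1
  have hx2 := hx.2
  have hsp : ∀ s ∈ Metric.ball r δ, 0 < s ∧ |s - r| ≤ δ := by
    intro s hs
    rw [Metric.mem_ball, Real.dist_eq] at hs
    exact ⟨by linarith [(abs_lt.1 hs).1], hs.le⟩
  have hle : (0:ℝ) ≤ x/2 := by linarith
  have hm1 : ∀ t ∈ Set.Ioc 0 (x/2), t ∈ Set.Ioo 0 (2 * Real.pi) := fun t ht => ⟨ht.1, by linarith [ht.2]⟩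
  have hm2 : ∀ t ∈ Set.Ioc 0 (x/2), x - t ∈ Set.Ioo 0 (2 * Real.pi) :=
    fun t ht => ⟨by linarith [ht.2], by linarith [ht.1]⟩
  refine intervalIntegral.hasDerivAt_integral_of_dominated_loc_of_deriv_le
      (F := fun s t => fT a s (x - t) * fT a s t)
      (F' := fun s t => -a * (vT s (x - t) + vT s t) * (fT a s (x - t) * fT a s t))
      (bound := fun t => (a * (C + C) * (M * (x/2) ^ (-a)) * M) * t ^ (-a)) (Metric.ball_mem_nhds r hδ) ?_ ?_ ?_ ?_ ?_ ?_
  · filter_upwards [Metric.ball_mem_nhds r hδ] with s hs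
    exact (half_integrable ha ha1 (hsp s hs).1 (fT_cont a (hsp s hs).1) hx).def'.aestronglyMeasurable
  · exact half_integrable ha ha1 hr (fT_cont a hr) hx
  · rw [Set.uIoc_of_le hle]
    refine ContinuousOn.aestronglyMeasurable ?_ measurableSet_Ioc
    have hsub : ContinuousOn (fun t : ℝ => x - t) (Set.Ioc 0 (x/2)) := by fun_prop
    exact (continuousOn_const.mul (((vT_cont hr).comp hsub hm2).add ((vT_cont hr).mono hm1))).mul
      (((fT_cont a hr).comp hsub hm2).mul ((fT_cont a hr).mono hm1))
  · refine Filter.Eventually.of_forall fun t ht s hs => ?_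
    rw [Set.uIoc_of_le hle] at ht
    obtain ⟨b1, b2⟩ := h s (hsp s hs).2 t ht.1 (by linarith [ht.2])
    obtain ⟨b3, b4⟩ := h s (hsp s hs).2 (x - t) (hm2 t ht).1 (by linarith [ht.1])
    have p1 := fT_pos (a := a) (hsp s hs).1 (hm1 t ht)
    have p2 := fT_pos (a := a) (hsp s hs).1 (hm2 t ht)
    have b5 : (x - t) ^ (-a) ≤ (x/2) ^ (-a) :=
      Real.rpow_le_rpow_of_nonpos (by linarith) (by linarith [ht.2]) (by linarith)
    have b6 : fT a s (x - t) ≤ M * (x/2) ^ (-a) := b3.trans (by gcongr)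
    rw [norm_mul, norm_mul, norm_mul, norm_neg, Real.norm_of_nonneg ha.le, Real.norm_of_nonneg p1.le,
      Real.norm_of_nonneg p2.le]
    have b7 : ‖vT s (x - t) + vT s t‖ ≤ C + C := (abs_add_le _ _).trans (add_le_add b4 b2)
    have q : 0 ≤ (x/2) ^ (-a) := by positivity
    calc a * ‖vT s (x - t) + vT s t‖ * (fT a s (x - t) * fT a s t)
        ≤ a * (C + C) * ((M * (x/2) ^ (-a)) * (M * t ^ (-a))) := by gcongr
      _ = _ := by ring
  · exact (intervalIntegral.intervalIntegrable_rpow' (by linarith)).const_mul _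
  · refine Filter.Eventually.of_forall fun t ht s hs => ?_
    rw [Set.uIoc_of_le hle] at ht
    refine ((fT_deriv_s (hsp s hs).1 (hm2 t ht)).mul (fT_deriv_s (hsp s hs).1 (hm1 t ht))).congr_deriv ?_
    ring

lemma ftc {κ : ℝ} (hκ : 4 < κ) {r : ℝ} (hr : 0 < r) {x : ℝ} (hx : x ∈ Set.Ioo 0 (2 * Real.pi)) :
    ((4/κ) * (rT 3 r 0 / rT 1 r 0) - (4/κ) * vT r x) * KT (4/κ) r x + (-4 * hT r x) * I1 (4/κ) r x
      + (-(κ/2)) * I2 (4/κ) r x + IS (4/κ) r x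
      = 2 * (hT r x - hT r (x/2)) * (fT (4/κ) r (x/2) * fT (4/κ) r (x/2)) := by
  have hκ0 : 0 < κ := by linarith
  set a := 4/κ with hadef
  have ha : 0 < a := by positivity
  have ha1 : a < 1 := by rw [hadef, div_lt_one hκ0]; exact hκ
  have hκa : κ * a = 4 := by rw [hadef]; field_simp
  have hx0 := hx.1
  have hx2 := hx.2
  set α := a * (rT 3 r 0 / rT 1 r 0) - a * vT r x with hα
  have i0 := (half_integrable ha ha1 hr (fT_cont a hr) hx).const_mul α
  have i1 := (half_integrable ha ha1 hr (f1_cont a hr) hx).const_mul (-4 * hT r x)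
  have i2 := (half_integrable ha ha1 hr (f2_cont a hr) hx).const_mul (-(κ/2))
  have i3 := (KT_deriv_s ha ha1 hr hx).1
  have hder : ∀ t ∈ Set.Ioo 0 (x/2), HasDerivAt (fun t => 2 * (hT r x - hT r (x - t)) * (fT a r (x - t) * fT a r t))
      (α * (fT a r (x - t) * fT a r t) + (-4 * hT r x) * (f1 a r (x - t) * fT a r t)
        + (-(κ/2)) * (f2 a r (x - t) * fT a r t)
        + -a * (vT r (x - t) + vT r t) * (fT a r (x - t) * fT a r t)) t := by
    intro t ht
    have hm1 : t ∈ Set.Ioo 0 (2 * Real.pi) := ⟨ht.1, by linarith [ht.2]⟩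
    have hm2 : x - t ∈ Set.Ioo 0 (2 * Real.pi) := ⟨by linarith [ht.2], by linarith [ht.1]⟩
    have d1 := (hT_deriv hr hm2).comp_const_sub x t
    have d2 := (fT_deriv (a := a) hr hm2).comp_const_sub x t
    have d3 := fT_deriv (a := a) hr hm1
    have hid := rT_identity hr hm1 hm2 hx
    change vT r x + vT r (x-t) + vT r t + 2 * hT r (x-t) * hT r t - 2 * hT r x * hT r (x-t)
      - 2 * hT r x * hT r t = _ at hid
    refine (((d1.const_sub (hT r x)).const_mul 2).mul (d2.mul d3)).congr_deriv ?_
    simp only [Pi.mul_apply, f1, f2, hα, ← hid]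
    linear_combination (-(1/2) * (vT r (x-t) - hT r (x-t)^2) + (1/2) * a * hT r (x-t)^2) *
      (fT a r (x - t) * fT a r t) * hκa
  have hm := half_mem hx
  have hlim0 : Filter.Tendsto (fun t => 2 * (hT r x - hT r (x - t)) * (fT a r (x - t) * fT a r t))
      (nhdsWithin 0 (Set.Ioi 0)) (nhds 0) := by
    obtain ⟨δ, hδ, hδr, M, hM, C, hC, h⟩ := fT_bound ha hr hx
    have dG : HasDerivAt (fun t => hT r (x - t)) (-(vT r (x-0) - hT r (x-0) ^ 2)) 0 :=
      HasDerivAt.comp_const_sub x 0 (by rw [sub_zero]; exact hT_deriv hr hx)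
    have l1 := (hasDerivAt_iff_tendsto_slope_zero.1 dG).mono_left
      (nhdsWithin_mono 0 (show Set.Ioi (0:ℝ) ⊆ {0}ᶜ from fun t ht => by simpa using (ne_of_gt ht)))
    have l2 : Filter.Tendsto (fun t => fT a r (x - t)) (nhdsWithin 0 (Set.Ioi 0)) (nhds (fT a r (x - 0))) := by
      have : ContinuousAt (fun t => fT a r (x - t)) 0 :=
        (HasDerivAt.comp_const_sub x 0 (f := fT a r) (f' := -a * hT r x * fT a r x)
          (by rw [sub_zero]; exact fT_deriv hr hx)).continuousAt
      exact this.tendsto.mono_left nhdsWithin_le_nhds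
    have l3 : Filter.Tendsto (fun t => t * fT a r t) (nhdsWithin 0 (Set.Ioi 0)) (nhds 0) := by
      have u : Filter.Tendsto (fun t : ℝ => M * t ^ (1 - a)) (nhdsWithin 0 (Set.Ioi 0)) (nhds 0) := by
        have : ContinuousAt (fun t : ℝ => M * t ^ (1 - a)) 0 :=
          continuousAt_const.mul (Real.continuousAt_rpow_const 0 (1 - a) (Or.inr (by linarith)))
        have := this.tendsto
        rw [Real.zero_rpow (by linarith), mul_zero] at this
        exact this.mono_left nhdsWithin_le_nhds
      refine squeeze_zero' ?_ ?_ u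
      · filter_upwards [Ioo_mem_nhdsGT hx0] with t ht
        exact mul_nonneg ht.1.le (fT_pos hr ⟨ht.1, by linarith [ht.2]⟩).le
      · filter_upwards [Ioo_mem_nhdsGT hx0] with t ht
        have := (h r (by simpa using hδ.le) t ht.1 ht.2.le).1
        rw [sub_eq_add_neg, Real.rpow_add ht.1, Real.rpow_one]
        calc t * fT a r t ≤ t * (M * t ^ (-a)) := by have := ht.1.le; gcongr
          _ = _ := by ring
    have l4 := ((l1.const_mul (-2)).mul l2).mul l3
    rw [mul_zero] at l4
    refine l4.congr' ?_
    filter_upwards [self_mem_nhdsWithin] with t ht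
    have ht : (0:ℝ) < t := ht
    simp only [smul_eq_mul, zero_add, sub_zero]
    field_simp
    ring
  have hlim1 : Filter.Tendsto (fun t => 2 * (hT r x - hT r (x - t)) * (fT a r (x - t) * fT a r t))
      (nhdsWithin (x/2) (Set.Iio (x/2))) (nhds (2 * (hT r x - hT r (x/2)) * (fT a r (x/2) * fT a r (x/2)))) := by
    have e : x - x/2 = x/2 := by ring
    have d1 : ContinuousAt (fun t => hT r (x - t)) (x/2) :=
      (HasDerivAt.comp_const_sub x (x/2) (by rw [e]; exact hT_deriv hr hm)).continuousAt
    have d2 : ContinuousAt (fun t => fT a r (x - t)) (x/2) :=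
      (HasDerivAt.comp_const_sub x (x/2) (by rw [e]; exact fT_deriv hr hm)).continuousAt
    have d3 : ContinuousAt (fun t => fT a r t) (x/2) := (fT_deriv hr hm).continuousAt
    have := ((continuousAt_const (y := (2:ℝ))).mul ((continuousAt_const (y := hT r x)).sub d1)).mul (d2.mul d3)
    have this : Filter.Tendsto (fun t => 2 * (hT r x - hT r (x - t)) * (fT a r (x - t) * fT a r t))
      (nhdsWithin (x/2) (Set.Iio (x/2)))
      (nhds (2 * (hT r x - hT r (x - x/2)) * (fT a r (x - x/2) * fT a r (x/2)))) :=
      this.tendsto.mono_left (nhdsWithin_le_nhds (s := Set.Iio (x/2)))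
    rw [e] at this
    exact this
  have key := intervalIntegral.integral_eq_sub_of_hasDerivAt_of_tendsto (by linarith : (0:ℝ) < x/2)
    hder (((i0.add i1).add i2).add i3) hlim0 hlim1
  rw [intervalIntegral.integral_add ((i0.add i1).add i2) i3, intervalIntegral.integral_add (i0.add i1) i2,
    intervalIntegral.integral_add i0 i1, intervalIntegral.integral_const_mul, intervalIntegral.integral_const_mul,
    intervalIntegral.integral_const_mul, sub_zero] at key
  exact key

open Complex MeasureTheory

lemma Hker_re {r : ℝ} (hr : 0 < r) (x : ℝ) : (Hker r (x:ℂ)).re = 2 * hT r x := by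
  unfold Hker hT
  rw [deriv_Theta hr, Theta_eq, rT_coe, rT_coe]
  rw [← Complex.ofReal_ofNat, ← Complex.ofReal_mul, ← Complex.ofReal_div, Complex.ofReal_re]
  ring

lemma Hker_deriv_re {r : ℝ} (hr : 0 < r) {x : ℝ} (hx : x ∈ Set.Ioo 0 (2 * Real.pi)) :
    (deriv (Hker r) (x:ℂ)).re = 2 * (vT r x - hT r x ^ 2) := by
  have h0 := rT0_pos hr hx
  have hne : thS 0 r (x:ℂ) ≠ 0 := by rw [rT_coe]; exact_mod_cast h0.ne'
  have e : Hker r = fun z => 2 * thS 1 r z / thS 0 r z := by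
    funext z; unfold Hker; rw [deriv_Theta hr, Theta_eq]
  have d := (((thS_hasDerivAt_z 1 hr (x:ℂ)).const_mul 2).div (thS_hasDerivAt_z 0 hr (x:ℂ)) hne)
  have e' : Hker r = (fun y => 2 * thS 1 r y) / thS 0 r := e
  rw [e', d.deriv]
  simp only [Nat.reduceAdd, rT_coe, vT, hT]
  have : ((2 * (rT 2 r x:ℂ)) * (rT 0 r x : ℂ) - 2 * (rT 1 r x : ℂ) * (rT 1 r x : ℂ)) / (rT 0 r x : ℂ)^2
    = ((2 * (rT 2 r x / rT 0 r x - (rT 1 r x / rT 0 r x)^2) : ℝ) : ℂ) := by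
    push_cast
    have : (rT 0 r x : ℂ) ≠ 0 := by exact_mod_cast h0.ne'
    field_simp
  rw [this, Complex.ofReal_re]

/-- Lawler–Zhan null-vector equation for the screened partition function,
excursion-reflected boundary condition. -/
theorem lawler_zhan_null_vector_ER (κ : ℝ) (hκ : 4 < κ)
    (r : ℝ) (hr : 0 < r) (x : ℝ) (hx : x ∈ Set.Ioo 0 (2 * Real.pi)) :
    0 < ZLZ κ r x ∧
    deriv (fun s => ZLZ κ s x) r =
      κ / 2 * deriv (fun y => deriv (ZLZ κ r) y) x +
      (Hker r (x : ℂ)).re * deriv (ZLZ κ r) x +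
      (3 / κ - 1 / 2) * (deriv (Hker r) (x : ℂ)).re * ZLZ κ r x -
      6 / κ * ((wzeta r (Real.pi : ℂ)).re / Real.pi) * ZLZ κ r x := by
  have hκ0 : 0 < κ := by linarith
  have hftc := ftc hκ hr hx
  have hid3 := rT3_wzeta hr
  obtain ⟨a, hadef⟩ : ∃ a, a = 4/κ := ⟨_, rfl⟩
  have ha : 0 < a := by rw [hadef]; positivity
  have ha1 : a < 1 := by rw [hadef, div_lt_one hκ0]; exact hκ
  have hZ : ∀ s, 0 < s → ∀ y ∈ Set.Ioo 0 (2 * Real.pi),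
      ZLZ κ s y = rT 1 s 0 ^ (6/κ) * rT 0 s y ^ (2/κ) * (2 * KT a s y) := by
    intro s hs y hy
    rw [ZLZ_eq hs, ← hadef, symm_int ha ha1 hs hy]
  have hnhd : Set.Ioo 0 (2 * Real.pi) ∈ nhds x := Ioo_mem_nhds hx.1 hx.2
  have hA := rT1_pos hr
  have hT0 := rT0_pos hr hx
  have hK := KT_pos ha ha1 hr hx
  set A := rT 1 r 0 ^ (6/κ) with hAdef
  have hApos : 0 < A := Real.rpow_pos_of_pos hA _
  -- first space derivative
  have hD1 : ∀ y ∈ Set.Ioo 0 (2 * Real.pi), HasDerivAt (ZLZ κ r)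
      (A * (2/κ * hT r y * rT 0 r y ^ (2/κ)) * (2 * KT a r y) +
        A * rT 0 r y ^ (2/κ) * (2 * (fT a r (y/2) * fT a r (y/2) / 2 + I1 a r y))) y := by
    intro y hy
    refine ((((pow_deriv_y (2/κ) hr hy).const_mul A).mul ((KT_deriv ha ha1 hr hy).const_mul 2))).congr_of_eventuallyEq ?_
    filter_upwards [Ioo_mem_nhds hy.1 hy.2] with z hz
    exact hZ r hr z hz
  -- second space derivative
  have hD2 := (((((hT_deriv hr hx).const_mul (2/κ)).mul (pow_deriv_y (2/κ) hr hx)).const_mul A).mul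
      ((KT_deriv ha ha1 hr hx).const_mul 2)).add
    (((pow_deriv_y (2/κ) hr hx).const_mul A).mul
      (((fhalf_deriv (a := a) hr hx).add (I1_deriv ha ha1 hr hx)).const_mul 2))
  have hE : (fun y => deriv (ZLZ κ r) y) =ᶠ[nhds x] fun y =>
      (A * (2/κ * hT r y * rT 0 r y ^ (2/κ)) * (2 * KT a r y) +
        A * rT 0 r y ^ (2/κ) * (2 * (fT a r (y/2) * fT a r (y/2) / 2 + I1 a r y))) := by
    filter_upwards [hnhd] with y hy
    exact (hD1 y hy).deriv
  have hD2' := hD2.congr_of_eventuallyEq (f₁ := fun y => deriv (ZLZ κ r) y) hE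
  -- time derivative
  have hpA : HasDerivAt (fun s => rT 1 s 0 ^ (6/κ)) (6/κ * (rT 3 r 0 / rT 1 r 0) * A) r := by
    refine ((rT_hasDerivAt_s 1 hr 0).rpow_const (p := 6/κ) (Or.inl hA.ne')).congr_deriv ?_
    rw [Real.rpow_sub_one hA.ne']
    simp only [Nat.reduceAdd]
    ring
  have hDs := (hpA.mul (pow_deriv_s (2/κ) hr hx)).mul ((KT_deriv_s ha ha1 hr hx).2.const_mul 2)
  have hDs' := hDs.congr_of_eventuallyEq (f₁ := fun s => ZLZ κ s x) (by
    filter_upwards [Ioi_mem_nhds hr] with s hs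
    exact hZ s hs x hx)
  refine ⟨?_, ?_⟩
  · rw [hZ r hr x hx]
    have := Real.rpow_pos_of_pos hT0 (2/κ)
    positivity
  · rw [hDs'.deriv, hD2'.deriv, (hD1 x hx).deriv, Hker_re hr, Hker_deriv_re hr hx, hZ r hr x hx]
    rw [← hadef] at hftc
    have hη : (wzeta r (Real.pi : ℂ)).re / Real.pi = -(1/3) * (rT 3 r 0 / rT 1 r 0) := by rw [hid3]; ring
    rw [hη]
    simp only [Pi.mul_apply, Pi.add_apply, ← hAdef]
    simp only [f1] at *
    clear hDs' hD2' hD2 hDs hE hD1 hZ hpA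
    generalize rT 3 r 0 / rT 1 r 0 = E at *
    generalize rT 0 r x ^ (2/κ) = B at *
    generalize KT a r x = K at *
    generalize I1 a r x = J1 at *
    generalize I2 a r x = J2 at *
    generalize IS a r x = J3 at *
    have hb : a = 4 * κ⁻¹ := by rw [hadef]; ring
    have hkk : κ * κ⁻¹ = 1 := mul_inv_cancel₀ hκ0.ne'
    simp only [div_eq_mul_inv] at *
    subst hb
    field_simp at hftc ⊢
    linear_combination (6 * B) * hftc
end

section
/- Degenerate (r → ∞) null-vector ODE for the screened partition function: fix κ > 4. For x ∈ (0,2π), define Z_∞(x) := sin(x/2)^{2/κ} · ∫_0^x sin((x−t)/2)^{−4/κ} sin(t/2)^{−4/κ} dt (the integral converges since −4/κ > −1). Then Z_∞ satisfies 0 = (κ/2)·Z_∞″(x) + cot(x/2)·Z_∞′(x) − (3/κ − 1/2)·(1/(2 sin²(x/2)))·Z_∞(x) − (1/(2κ))·Z_∞(x) for all x ∈ (0,2π). -/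
/-- The degenerate (r → ∞) screened partition function
Z_∞(x) = sin(x/2)^{2/κ} ∫_0^x sin((x−t)/2)^{−4/κ} sin(t/2)^{−4/κ} dt. -/
noncomputable def Zinf (κ x : ℝ) : ℝ :=
  (Real.sin (x / 2)) ^ ((2 : ℝ) / κ) *
  ∫ t in (0 : ℝ)..x,
    (Real.sin ((x - t) / 2)) ^ (-((4 : ℝ) / κ)) *
    (Real.sin (t / 2)) ^ (-((4 : ℝ) / κ))

open MeasureTheory Set Filter Topology

noncomputable def auxM (a : ℝ) (k : ℕ) (e q : ℝ) : ℝ :=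
  ∫ v in Ioo (-1 : ℝ) 1, (1 - v ^ 2) ^ (-a) * (v ^ (2 * k) * (1 + q * v ^ 2) ^ e)

lemma aux_int0 (a : ℝ) (h0 : 0 < a) (h1 : a < 1) :
    IntegrableOn (fun v : ℝ => (1 - v ^ 2) ^ (-a)) (Ioo (-1 : ℝ) 1) := by
  have hA : IntervalIntegrable (fun v : ℝ => v ^ (-a)) volume 0 2 :=
    intervalIntegral.intervalIntegrable_rpow' (by linarith)
  have hB : IntegrableOn (fun v : ℝ => (1 + v) ^ (-a)) (Ioo (-1 : ℝ) 1) := by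
    have := hA.comp_add_left 1
    norm_num at this
    rw [intervalIntegrable_iff_integrableOn_Ioo_of_le (by norm_num)] at this
    exact this
  have hC : IntegrableOn (fun v : ℝ => (1 - v) ^ (-a)) (Ioo (-1 : ℝ) 1) := by
    have := (hA.comp_sub_left 1).symm
    norm_num at this
    rw [intervalIntegrable_iff_integrableOn_Ioo_of_le (by norm_num)] at this
    exact this
  refine Integrable.mono' (hB.add hC) (Measurable.aestronglyMeasurable (by fun_prop)) ?_
  refine (ae_restrict_iff' measurableSet_Ioo).2 (Eventually.of_forall ?_)
  intro v hv
  have p1 : 0 < 1 + v := by linarith [hv.1]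
  have p2 : 0 < 1 - v := by linarith [hv.2]
  have e1 : (1 - v ^ 2) = (1 + v) * (1 - v) := by ring
  have r1 := Real.rpow_pos_of_pos p1 (-a)
  have r2 := Real.rpow_pos_of_pos p2 (-a)
  rw [Real.norm_eq_abs, e1, Real.mul_rpow p1.le p2.le, abs_of_pos (by positivity)]
  simp only [Pi.add_apply]
  rcases le_total 0 v with h | h
  · have : (1 + v) ^ (-a) ≤ 1 := Real.rpow_le_one_of_one_le_of_nonpos (by linarith) (by linarith)
    nlinarith
  · have : (1 - v) ^ (-a) ≤ 1 := Real.rpow_le_one_of_one_le_of_nonpos (by linarith) (by linarith)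
    nlinarith

lemma aux_bd (k : ℕ) (e q v : ℝ) (hq : 0 ≤ q) (he : e ≤ 0) (hv : v ∈ Ioo (-1 : ℝ) 1) :
    |v ^ (2 * k) * (1 + q * v ^ 2) ^ e| ≤ 1 := by
  have hb : 1 ≤ 1 + q * v ^ 2 := by nlinarith [sq_nonneg v, mul_nonneg hq (sq_nonneg v)]
  have h1 : (1 + q * v ^ 2) ^ e ≤ 1 := Real.rpow_le_one_of_one_le_of_nonpos hb he
  have h2 : 0 ≤ (1 + q * v ^ 2) ^ e := Real.rpow_nonneg (by linarith) _
  have hs : v ^ 2 ≤ 1 := by nlinarith [hv.1, hv.2]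
  have h3 : v ^ (2 * k) ≤ 1 := by rw [pow_mul]; exact pow_le_one₀ (sq_nonneg v) hs
  have h4 : 0 ≤ v ^ (2 * k) := by rw [pow_mul]; positivity
  rw [abs_of_nonneg (by positivity)]
  exact mul_le_one₀ h3 h2 h1

lemma aux_int (a : ℝ) (h0 : 0 < a) (h1 : a < 1) (k : ℕ) (e q : ℝ) (hq : 0 ≤ q) (he : e ≤ 0) :
    IntegrableOn (fun v : ℝ => (1 - v ^ 2) ^ (-a) * (v ^ (2 * k) * (1 + q * v ^ 2) ^ e))
      (Ioo (-1 : ℝ) 1) := by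
  refine Integrable.mono' (aux_int0 a h0 h1) (by fun_prop) ?_
  refine (ae_restrict_iff' measurableSet_Ioo).2 (Eventually.of_forall ?_)
  intro v hv
  have hp : 0 ≤ (1 - v ^ 2) ^ (-a) := Real.rpow_nonneg (by nlinarith [hv.1, hv.2]) _
  rw [norm_mul, Real.norm_eq_abs, Real.norm_eq_abs, abs_of_nonneg hp]
  exact mul_le_of_le_one_right hp (aux_bd k e q v hq he hv)

lemma aux_deriv (a : ℝ) (h0 : 0 < a) (h1 : a < 1) (k : ℕ) (e q : ℝ) (hq : 0 < q) (he : e ≤ 0) :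
    HasDerivAt (fun q => auxM a k e q) (e * auxM a (k + 1) (e - 1) q) q := by
  have key := hasDerivAt_integral_of_dominated_loc_of_deriv_le
    (μ := volume.restrict (Ioo (-1 : ℝ) 1))
    (F := fun q v : ℝ => (1 - v ^ 2) ^ (-a) * (v ^ (2 * k) * (1 + q * v ^ 2) ^ e))
    (F' := fun q v : ℝ => e *
      ((1 - v ^ 2) ^ (-a) * (v ^ (2 * (k + 1)) * (1 + q * v ^ 2) ^ (e - 1))))
    (bound := fun v => |e| * (1 - v ^ 2) ^ (-a)) (x₀ := q) (s := Ioi 0)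
    (Ioi_mem_nhds hq)
    (Eventually.of_forall fun q => by fun_prop)
    (aux_int a h0 h1 k e q hq.le he) (by fun_prop) ?_ ((aux_int0 a h0 h1).const_mul _) ?_
  · have := key.2
    rw [integral_const_mul] at this
    exact this
  · refine (ae_restrict_iff' measurableSet_Ioo).2 (Eventually.of_forall ?_)
    intro v hv r hr
    have hp : 0 ≤ (1 - v ^ 2) ^ (-a) := Real.rpow_nonneg (by nlinarith [hv.1, hv.2]) _
    rw [norm_mul, norm_mul, Real.norm_eq_abs, Real.norm_eq_abs, Real.norm_eq_abs, abs_of_nonneg hp]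
    exact mul_le_mul_of_nonneg_left (mul_le_of_le_one_right hp
      (aux_bd (k + 1) (e - 1) r v (le_of_lt hr) (by linarith) hv)) (abs_nonneg e)
  · refine (ae_restrict_iff' measurableSet_Ioo).2 (Eventually.of_forall ?_)
    intro v hv r hr
    have hr' : 0 < r := hr
    have hpos : 0 < 1 + r * v ^ 2 := by positivity
    have hd : HasDerivAt (fun r : ℝ => 1 + r * v ^ 2) (v ^ 2) r := by
      simpa using ((hasDerivAt_id r).mul_const (v ^ 2)).const_add 1
    have := ((hd.rpow_const (p := e) (Or.inl hpos.ne')).const_mul (v ^ (2 * k))).const_mul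
      ((1 - v ^ 2) ^ (-a))
    refine this.congr_deriv ?_
    ring

lemma aux_hyp (a : ℝ) (h0 : 0 < a) (h1 : a < 1) (q : ℝ) (hq : 0 < q) :
    q * (1 + q) * ((a - 1) * (a - 2) * auxM a 2 (a - 3) q)
      + ((3 / 2 - a) + (5 / 2 - a) * q) * ((a - 1) * auxM a 1 (a - 2) q)
      + (1 - a) / 2 * auxM a 0 (a - 1) q = 0 := by
  have i2 := (aux_int a h0 h1 2 (a - 3) q hq.le (by linarith)).const_mul
    (q * (1 + q) * ((a - 1) * (a - 2)))
  have i1 := (aux_int a h0 h1 1 (a - 2) q hq.le (by linarith)).const_mul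
    (((3 / 2 - a) + (5 / 2 - a) * q) * (a - 1))
  have i0 := (aux_int a h0 h1 0 (a - 1) q hq.le (by linarith)).const_mul ((1 - a) / 2)
  have hsum := (i2.add i1).add i0
  have e1 := integral_add (i2.add i1) i0
  have e2 := integral_add i2 i1
  simp only [Pi.add_apply] at e1
  rw [e2, integral_const_mul, integral_const_mul, integral_const_mul] at e1
  have hq0 : ∀ v : ℝ, 0 < 1 + q * v ^ 2 := fun v => by positivity
  have ftc := intervalIntegral.integral_eq_sub_of_hasDerivAt_of_le
    (a := -1) (b := 1) (by norm_num)
    (f := fun v : ℝ => (1 - a) / 2 * (v * ((1 - v ^ 2) ^ (1 - a) * (1 + q * v ^ 2) ^ (a - 2))))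
    (f' := fun v : ℝ =>
      q * (1 + q) * ((a - 1) * (a - 2)) *
        ((1 - v ^ 2) ^ (-a) * (v ^ (2 * 2) * (1 + q * v ^ 2) ^ (a - 3)))
      + ((3 / 2 - a) + (5 / 2 - a) * q) * (a - 1) *
        ((1 - v ^ 2) ^ (-a) * (v ^ (2 * 1) * (1 + q * v ^ 2) ^ (a - 2)))
      + (1 - a) / 2 * ((1 - v ^ 2) ^ (-a) * (v ^ (2 * 0) * (1 + q * v ^ 2) ^ (a - 1))))
    ?_ ?_ ?_
  · rw [intervalIntegral.integral_of_le (by norm_num), integral_Ioc_eq_integral_Ioo] at ftc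
    rw [ftc] at e1
    have hz : (0 : ℝ) ^ (1 - a) = 0 := Real.zero_rpow (by linarith)
    norm_num [hz] at e1
    unfold auxM
    norm_num
    linarith
  · refine Continuous.continuousOn ?_
    have c1 : Continuous fun v : ℝ => (1 - v ^ 2) ^ (1 - a) :=
      Continuous.rpow_const (by fun_prop) (fun v => Or.inr (by linarith))
    have c2 : Continuous fun v : ℝ => (1 + q * v ^ 2) ^ (a - 2) :=
      Continuous.rpow_const (by fun_prop) (fun v => Or.inl (hq0 v).ne')
    fun_prop
  · intro v hv
    have hA : 0 < 1 - v ^ 2 := by nlinarith [hv.1, hv.2]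
    have hB := hq0 v
    have d1 : HasDerivAt (fun v : ℝ => 1 - v ^ 2) (-(2 * v)) v := by
      simpa using (hasDerivAt_pow 2 v).const_sub 1
    have d2 : HasDerivAt (fun v : ℝ => 1 + q * v ^ 2) (q * (2 * v)) v := by
      simpa using ((hasDerivAt_pow 2 v).const_mul q).const_add 1
    have d := ((hasDerivAt_id v).mul ((d1.rpow_const (p := 1 - a) (Or.inl hA.ne')).mul
      (d2.rpow_const (p := a - 2) (Or.inl hB.ne')))).const_mul ((1 - a) / 2)
    refine d.congr_deriv ?_
    have s1 : (1 - v ^ 2) ^ (1 - a) = (1 - v ^ 2) ^ (-a) * (1 - v ^ 2) := by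
      rw [← Real.rpow_add_one hA.ne']; congr 1; ring
    have s1' : (1 - v ^ 2) ^ (1 - a - 1) = (1 - v ^ 2) ^ (-a) := by congr 1; ring
    have s2' : (1 + q * v ^ 2) ^ (a - 2 - 1) = (1 + q * v ^ 2) ^ (a - 3) := by congr 1; ring
    have s2 : (1 + q * v ^ 2) ^ (a - 2) = (1 + q * v ^ 2) ^ (a - 3) * (1 + q * v ^ 2) := by
      rw [← Real.rpow_add_one hB.ne']; congr 1; ring
    have s3 : (1 + q * v ^ 2) ^ (a - 1)
        = (1 + q * v ^ 2) ^ (a - 3) * (1 + q * v ^ 2) * (1 + q * v ^ 2) := by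
      rw [← s2, ← Real.rpow_add_one hB.ne']; congr 1; ring
    simp only [id_eq, Pi.mul_apply]
    rw [s1, s1', s2', s3, s2]
    ring
  · rw [intervalIntegrable_iff_integrableOn_Ioo_of_le (by norm_num)]
    exact hsum

lemma aux_trig (y : ℝ) (hy : y ∈ Ioo 0 (2 * Real.pi)) :
    0 < Real.tan (y / 4) ∧ Real.arctan (Real.tan (y / 4)) = y / 4 ∧
    Real.sin (y / 2) = 2 * Real.tan (y / 4) / (1 + Real.tan (y / 4) ^ 2) ∧
    Real.cos (y / 2) = (1 - Real.tan (y / 4) ^ 2) / (1 + Real.tan (y / 4) ^ 2) ∧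
    HasDerivAt (fun y => Real.tan (y / 4)) ((1 + Real.tan (y / 4) ^ 2) / 4) y := by
  have l1 : 0 < y / 4 := by linarith [hy.1]
  have l2 : y / 4 < Real.pi / 2 := by linarith [hy.2]
  have hc : 0 < Real.cos (y / 4) := Real.cos_pos_of_mem_Ioo ⟨by linarith, l2⟩
  have hsc := Real.sin_sq_add_cos_sq (y / 4)
  have hy2 : y / 2 = 2 * (y / 4) := by ring
  have hT : Real.tan (y / 4) = Real.sin (y / 4) / Real.cos (y / 4) := Real.tan_eq_sin_div_cos _
  have h1T : 1 + Real.tan (y / 4) ^ 2 = 1 / Real.cos (y / 4) ^ 2 := by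
    rw [hT]; field_simp; linarith
  refine ⟨Real.tan_pos_of_pos_of_lt_pi_div_two l1 l2, Real.arctan_tan (by linarith) l2, ?_, ?_, ?_⟩
  · rw [h1T, hT, hy2, Real.sin_two_mul]; field_simp
  · rw [h1T, hT, hy2, Real.cos_two_mul]; field_simp; linarith
  · rw [h1T]
    have := (Real.hasDerivAt_tan hc.ne').comp y ((hasDerivAt_id y).div_const 4)
    refine this.congr_deriv ?_
    ring

lemma aux_subst (a y : ℝ) (hy : y ∈ Ioo 0 (2 * Real.pi)) (T : ℝ) (hT : T = Real.tan (y / 4)) :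
    ∫ t in (0 : ℝ)..y, (Real.sin ((y - t) / 2)) ^ (-a) * (Real.sin (t / 2)) ^ (-a)
    = 2 * T * T ^ (-(2 * a)) * (1 + T ^ 2) ^ a * auxM a 0 (a - 1) (T ^ 2) := by
  obtain ⟨hT0, hat, -, -, -⟩ := aux_trig y hy
  rw [← hT] at hT0 hat
  have him : (fun v => y / 2 + 2 * Real.arctan (T * v)) '' Ioo (-1 : ℝ) 1 = Ioo 0 y := by
    ext t
    constructor
    · rintro ⟨v, hv, rfl⟩
      have u1 : Real.arctan (T * v) < Real.arctan T :=
        Real.arctan_strictMono (by nlinarith [hv.2])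
      have u2 : Real.arctan (-T) < Real.arctan (T * v) :=
        Real.arctan_strictMono (by nlinarith [hv.1])
      rw [Real.arctan_neg] at u2
      constructor <;> simp only <;> linarith
    · intro ht
      have l1 : -(y / 4) < (t - y / 2) / 2 := by linarith [ht.1]
      have l2 : (t - y / 2) / 2 < y / 4 := by linarith [ht.2]
      have l3 : y / 4 < Real.pi / 2 := by linarith [hy.2]
      have m1 : Real.tan ((t - y / 2) / 2) < T := by
        rw [hT]; exact Real.tan_lt_tan_of_lt_of_lt_pi_div_two (by linarith) l3 l2
      have m2 : -T < Real.tan ((t - y / 2) / 2) := by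
        rw [hT, ← Real.tan_neg]
        exact Real.tan_lt_tan_of_lt_of_lt_pi_div_two (by linarith) (by linarith) l1
      refine ⟨Real.tan ((t - y / 2) / 2) / T, ⟨?_, ?_⟩, ?_⟩
      · rw [lt_div_iff₀ hT0]; linarith
      · rw [div_lt_iff₀ hT0]; linarith
      · simp only
        rw [mul_div_cancel₀ _ hT0.ne', Real.arctan_tan (by linarith) (by linarith)]
        ring
  rw [intervalIntegral.integral_of_le hy.1.le, integral_Ioc_eq_integral_Ioo, ← him,
    integral_image_eq_integral_abs_deriv_smul (f' := fun v => 2 * T / (1 + T ^ 2 * v ^ 2))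
      measurableSet_Ioo]
  · unfold auxM
    rw [← integral_const_mul]
    refine setIntegral_congr_fun measurableSet_Ioo ?_
    intro v hv
    have hA : 0 < 1 - v ^ 2 := by nlinarith [hv.1, hv.2]
    have p1 : 0 < 1 + v := by linarith [hv.1]
    have p2 : 0 < 1 - v := by linarith [hv.2]
    have hB : 0 < 1 + T ^ 2 * v ^ 2 := by positivity
    have hC : 0 < 1 + T ^ 2 := by positivity
    have a1 : (y - (y / 2 + 2 * Real.arctan (T * v))) / 2
        = Real.arctan T - Real.arctan (T * v) := by rw [hat]; ring
    have a2 : (y / 2 + 2 * Real.arctan (T * v)) / 2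
        = Real.arctan T + Real.arctan (T * v) := by rw [hat]; ring
    have hB' : 1 + (T * v) ^ 2 = 1 + T ^ 2 * v ^ 2 := by ring
    have b1 : Real.sin (Real.arctan T - Real.arctan (T * v))
        = T * (1 - v) / (√(1 + T ^ 2) * √(1 + T ^ 2 * v ^ 2)) := by
      rw [Real.sin_sub, Real.sin_arctan, Real.sin_arctan, Real.cos_arctan, Real.cos_arctan, hB']
      field_simp
    have b2 : Real.sin (Real.arctan T + Real.arctan (T * v))
        = T * (1 + v) / (√(1 + T ^ 2) * √(1 + T ^ 2 * v ^ 2)) := by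
      rw [Real.sin_add, Real.sin_arctan, Real.sin_arctan, Real.cos_arctan, Real.cos_arctan, hB']
      field_simp
    simp only [smul_eq_mul]
    rw [a1, a2, b1, b2, ← Real.mul_rpow (by positivity) (by positivity),
      abs_of_pos (by positivity)]
    have b3 : T * (1 - v) / (√(1 + T ^ 2) * √(1 + T ^ 2 * v ^ 2)) *
        (T * (1 + v) / (√(1 + T ^ 2) * √(1 + T ^ 2 * v ^ 2)))
        = T ^ 2 * (1 - v ^ 2) / ((1 + T ^ 2) * (1 + T ^ 2 * v ^ 2)) := by
      have q1 := Real.sq_sqrt hC.le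
      have q2 := Real.sq_sqrt hB.le
      rw [div_mul_div_comm]
      congr 1
      · ring
      · nth_rewrite 3 [← q1]
        nth_rewrite 3 [← q2]
        ring
    have b4 : (T ^ 2) ^ (-a) = T ^ (-(2 * a)) := by
      rw [← Real.rpow_natCast, ← Real.rpow_mul hT0.le]; congr 1; push_cast; ring
    rw [b3, Real.div_rpow (by positivity) (by positivity), Real.mul_rpow (by positivity) hA.le,
      Real.mul_rpow hC.le hB.le, b4, Real.rpow_neg hC.le a, Real.rpow_neg hB.le a,
      Real.rpow_sub_one hB.ne']
    have := Real.rpow_pos_of_pos hC a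
    have := Real.rpow_pos_of_pos hB a
    field_simp
    simp
  · intro v hv
    refine HasDerivAt.hasDerivWithinAt ?_
    have := (((Real.hasDerivAt_arctan (T * v)).comp v
      ((hasDerivAt_id v).const_mul T)).const_mul 2).const_add (y / 2)
    refine this.congr_deriv ?_
    rw [mul_pow]; field_simp
  · intro v hv w hw h
    have h' : Real.arctan (T * v) = Real.arctan (T * w) := by simp only at h; linarith
    exact mul_left_cancel₀ hT0.ne' (Real.arctan_injective h')

lemma aux_Z (κ : ℝ) (hκ : 4 < κ) (a : ℝ) (ha : a = 4 / κ) (y : ℝ)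
    (hy : y ∈ Ioo 0 (2 * Real.pi)) (T : ℝ) (hT : T = Real.tan (y / 4)) :
    Zinf κ y = 2 * 2 ^ (a / 2) *
      (T ^ (1 - 3 * a / 2) * (1 + T ^ 2) ^ (a / 2) * auxM a 0 (a - 1) (T ^ 2)) := by
  obtain ⟨hT0, -, hs, -, -⟩ := aux_trig y hy
  rw [← hT] at hT0 hs
  have hC : 0 < 1 + T ^ 2 := by positivity
  unfold Zinf
  have e2 : 2 / κ = a / 2 := by rw [ha]; ring
  rw [← ha, aux_subst a y hy T hT, hs, e2, Real.div_rpow (by positivity) hC.le,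
    Real.mul_rpow (by norm_num) hT0.le]
  have c1 : (1 + T ^ 2) ^ a = (1 + T ^ 2) ^ (a / 2) * (1 + T ^ 2) ^ (a / 2) := by
    rw [← Real.rpow_add hC]; congr 1; ring
  have c2 : T ^ (1 - 3 * a / 2) = T * T ^ (-(2 * a)) * T ^ (a / 2) := by
    rw [mul_assoc, ← Real.rpow_add hT0]
    nth_rewrite 2 [← Real.rpow_one T]
    rw [← Real.rpow_add hT0]
    congr 1; ring
  rw [c1, c2]
  have := Real.rpow_pos_of_pos hC (a / 2)
  field_simp

lemma aux_W (p b T : ℝ) (hT : 0 < T) (R : ℝ → ℝ) (R' : ℝ) (hR : HasDerivAt R R' T) :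
    HasDerivAt (fun T => T ^ p * (1 + T ^ 2) ^ b * R T)
      (T ^ p * (1 + T ^ 2) ^ b * ((p / T + 2 * b * T / (1 + T ^ 2)) * R T + R')) T := by
  have hC : 0 < 1 + T ^ 2 := by positivity
  have d1 : HasDerivAt (fun T : ℝ => 1 + T ^ 2) (2 * T) T := by
    simpa using (hasDerivAt_pow 2 T).const_add 1
  have d := ((Real.hasDerivAt_rpow_const (x := T) (p := p) (Or.inl hT.ne')).mul
    (d1.rpow_const (p := b) (Or.inl hC.ne'))).mul hR
  refine d.congr_deriv ?_
  rw [Real.rpow_sub_one hT.ne', Real.rpow_sub_one hC.ne']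
  simp only [Pi.mul_apply]
  field_simp

lemma aux_M2 (a : ℝ) (h0 : 0 < a) (h1 : a < 1) (k : ℕ) (e T : ℝ) (hT : 0 < T) (he : e ≤ 0) :
    HasDerivAt (fun T => auxM a k e (T ^ 2)) (e * auxM a (k + 1) (e - 1) (T ^ 2) * (2 * T)) T := by
  have d1 : HasDerivAt (fun T : ℝ => T ^ 2) (2 * T) T := by
    simpa using hasDerivAt_pow 2 T
  exact (aux_deriv a h0 h1 k e (T ^ 2) (by positivity) he).comp T d1

/-- Degenerate (r → ∞) null-vector ODE for the screened partition function. -/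
theorem degenerate_null_vector_ODE (κ : ℝ) (hκ : 4 < κ)
    (x : ℝ) (hx : x ∈ Set.Ioo 0 (2 * Real.pi)) :
    0 = κ / 2 * deriv (fun y => deriv (Zinf κ) y) x +
      (Real.cos (x / 2) / Real.sin (x / 2)) * deriv (Zinf κ) x -
      (3 / κ - 1 / 2) * (1 / (2 * Real.sin (x / 2) ^ 2)) * Zinf κ x -
      1 / (2 * κ) * Zinf κ x := by
  obtain ⟨a, ha⟩ : ∃ a, a = 4 / κ := ⟨_, rfl⟩
  have hκ0 : 0 < κ := by linarith
  have h0 : 0 < a := by rw [ha]; positivity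
  have h1 : a < 1 := by rw [ha, div_lt_one hκ0]; exact hκ
  have hκa : κ = 4 / a := by rw [ha]; field_simp
  -- first derivative
  have hD1 : ∀ y ∈ Ioo 0 (2 * Real.pi), deriv (Zinf κ) y =
      2 * 2 ^ (a / 2) * ((Real.tan (y / 4)) ^ (1 - 3 * a / 2) *
        (1 + (Real.tan (y / 4)) ^ 2) ^ (a / 2) *
        (((1 - 3 * a / 2) * (1 + (Real.tan (y / 4)) ^ 2) / Real.tan (y / 4)
            + a * Real.tan (y / 4)) / 4 * auxM a 0 (a - 1) ((Real.tan (y / 4)) ^ 2)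
          + Real.tan (y / 4) * (1 + (Real.tan (y / 4)) ^ 2) / 2 *
            ((a - 1) * auxM a 1 (a - 2) ((Real.tan (y / 4)) ^ 2)))) := by
    intro y hy
    obtain ⟨hT0, -, -, -, hd⟩ := aux_trig y hy
    have hev : Zinf κ =ᶠ[𝓝 y] fun y => 2 * 2 ^ (a / 2) *
        ((fun T => T ^ (1 - 3 * a / 2) * (1 + T ^ 2) ^ (a / 2) * auxM a 0 (a - 1) (T ^ 2))
          (Real.tan (y / 4))) := by
      filter_upwards [isOpen_Ioo.mem_nhds hy] with z hz
      exact aux_Z κ hκ a ha z hz _ rfl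
    rw [hev.deriv_eq]
    have w := aux_W (1 - 3 * a / 2) (a / 2) _ hT0 _ _
      (aux_M2 a h0 h1 0 (a - 1) _ hT0 (by linarith))
    have := ((w.comp y hd).const_mul (2 * 2 ^ (a / 2))).deriv
    refine this.trans ?_
    have e3 : a - 1 - 1 = a - 2 := by ring
    rw [e3]
    generalize Real.tan (y / 4) = T at *
    have hC : 0 < 1 + T ^ 2 := by positivity
    simp only [zero_add]
    field_simp
    ring
  obtain ⟨hT0, -, hs, hc, hd⟩ := aux_trig x hx
  have hev' : (fun y => deriv (Zinf κ) y) =ᶠ[𝓝 x] fun y => 2 * 2 ^ (a / 2) *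
      ((fun T => T ^ (1 - 3 * a / 2) * (1 + T ^ 2) ^ (a / 2) *
        ((fun T => ((1 - 3 * a / 2) * (1 + T ^ 2) / T + a * T) / 4 * auxM a 0 (a - 1) (T ^ 2)
        + T * (1 + T ^ 2) / 2 * ((a - 1) * auxM a 1 (a - 2) (T ^ 2))) T))
        (Real.tan (y / 4))) := by
    filter_upwards [isOpen_Ioo.mem_nhds hx] with z hz
    exact hD1 z hz
  have d1 : ∀ T : ℝ, HasDerivAt (fun T : ℝ => 1 + T ^ 2) (2 * T) T := fun T => by
    simpa using (hasDerivAt_pow 2 T).const_add 1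
  have g0 := aux_M2 a h0 h1 0 (a - 1) _ hT0 (by linarith)
  have g1 := aux_M2 a h0 h1 1 (a - 2) _ hT0 (by linarith)
  have dP := ((((d1 (Real.tan (x / 4))).const_mul (1 - 3 * a / 2)).div
    (hasDerivAt_id _) hT0.ne').add ((hasDerivAt_id _).const_mul a)).div_const 4
  have dQ := ((hasDerivAt_id (Real.tan (x / 4))).mul (d1 (Real.tan (x / 4)))).div_const 2
  have w := aux_W (1 - 3 * a / 2) (a / 2) _ hT0 _ _
    ((dP.mul g0).add (dQ.mul (g1.const_mul (a - 1))))
  have hD2 := hev'.deriv_eq.trans ((w.comp x hd).const_mul (2 * 2 ^ (a / 2))).deriv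
  rw [hD2, hD1 x hx, aux_Z κ hκ a ha x hx _ rfl, hs, hc, hκa]
  have e3 : a - 1 - 1 = a - 2 := by ring
  have e4 : a - 2 - 1 = a - 3 := by ring
  have hyp := aux_hyp a h0 h1 (Real.tan (x / 4) ^ 2) (by positivity)
  rw [e3, e4]
  simp only [Pi.add_apply, Pi.mul_apply, Pi.div_apply, id_eq, zero_add, one_add_one_eq_two]
  clear hD2 hD1 hd hs hc e3 e4 w dP dQ g0 g1 d1 hev'
  generalize Real.tan (x / 4) = T at *
  have hC : 0 < 1 + T ^ 2 := by positivity
  generalize auxM a 2 (a - 3) (T ^ 2) = G2 at *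
  generalize auxM a 1 (a - 2) (T ^ 2) = G1 at *
  generalize auxM a 0 (a - 1) (T ^ 2) = G0 at *
  generalize T ^ (1 - 3 * a / 2) * (1 + T ^ 2) ^ (a / 2) = W at *
  generalize (2 : ℝ) ^ (a / 2) = C at *
  have hyp' := congrArg (fun z => C * W * z) hyp
  field_simp
  field_simp at hyp'
  ring_nf
  ring_nf at hyp'
  linear_combination (-(16 * T ^ 2 + 16 * T ^ 4)) * hyp'
end
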